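/- arXiv:1811.09695 — 2 statements merged into one kernel-verified Lean document; each statement's English description precedes it below -/
import Mathlib

section
/- Let W be a BI-DMC with P_0 = W(·|0) everywhere positive and P_1 = W(·|1). For N a power of 2 let P_PPM^N be the pmf on 𝒴^N given by P_PPM^N(y_1,…,y_N) = (1/N) Σ_{j=1}^N P_1(y_j) ∏_{h≠j} P_0(y_h), with the convention P_PPM^1 = P_1. Let X_1,…,X_q be i.i.d. uniform bits and Ỹ the output of the PPM super channel W̃ on input X_{1:q}. Then for every i ∈ {1,…,q}, the capacity of the i-th level satisfies the identity I(X_i; Ỹ | X_{i+1:q}) = D( P_PPM^{2^{i−1}} ‖ P_0^{⊗2^{i−1}} ) − D( P_PPM^{2^i} ‖ P_0^{⊗2^i} ); in particular this quantity does not depend on q ≥ i. -/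
open Finset

def IsPMF {𝒵 : Type} [Fintype 𝒵] (P : 𝒵 → ℝ) : Prop :=
  (∀ z, 0 ≤ P z) ∧ ∑ z, P z = 1

/-- Least-significant-bit-first binary-to-decimal map. -/
def dIdx (q : ℕ) (x : Fin q → Bool) : ℕ :=
  ∑ j : Fin q, if x j then 2^(j:ℕ) else 0

lemma sum_two_pow (q : ℕ) : ∑ j ∈ Finset.range q, 2^j = 2^q - 1 := by
  induction q with
  | zero => simp
  | succ q ih =>
    rw [Finset.sum_range_succ, ih, pow_succ]
    have : 0 < 2^q := pow_pos (by norm_num) q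
    omega

lemma dIdx_lt (q : ℕ) (x : Fin q → Bool) : dIdx q x < 2^q := by
  have h1 : dIdx q x ≤ ∑ j : Fin q, 2^(j:ℕ) := by
    apply Finset.sum_le_sum
    intro j _
    split <;> simp
  have h2 : ∑ j : Fin q, 2^(j:ℕ) = 2^q - 1 := by
    rw [Fin.sum_univ_eq_sum_range (fun j => 2^j) q, sum_two_pow]
  have : 0 < 2^q := pow_pos (by norm_num) q
  omega

/-- Position (0-indexed) of the `1` in the PPM symbol encoding `x`. -/
def ppmPos (q : ℕ) (x : Fin q → Bool) : Fin (2^q) := ⟨dIdx q x, dIdx_lt q x⟩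

/-- PPM super channel of the binary-input channel `W`:
`W̃(yt|x) = P1(y_{d(x)}) ∏_{h ≠ d(x)} P0(y_h)`. -/
noncomputable def superCh {𝒴 : Type} [Fintype 𝒴] [DecidableEq 𝒴] (W : Bool → 𝒴 → ℝ)
    (q : ℕ) (x : Fin q → Bool) (yt : Fin (2^q) → 𝒴) : ℝ :=
  W true (yt (ppmPos q x)) * ∏ h ∈ univ.erase (ppmPos q x), W false (yt h)

/-- Conditional output pmf of the PPM super channel given the inputs off `S`:
`P_{Ỹ|X_{S^c}}(yt|x_{S^c}) = 2^{−|S|} ∑_{x_S} W̃(yt|x)`. -/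
noncomputable def condOut {𝒴 : Type} [Fintype 𝒴] [DecidableEq 𝒴] (W : Bool → 𝒴 → ℝ)
    (q : ℕ) (S : Finset (Fin q)) (x : Fin q → Bool) (yt : Fin (2^q) → 𝒴) : ℝ :=
  ((2:ℝ)^S.card)⁻¹ * ∑ xs : {i : Fin q // i ∈ S} → Bool,
    superCh W q (fun i => if h : i ∈ S then xs ⟨i, h⟩ else x i) yt

/-- Information density expectation `∑_{x,yt} 2^{−q} W̃(yt|x) log( P(yt|x_{A^c}) / P(yt|x_{B^c}) )`
(natural logarithm); with `A = ∅` and `B = S` this is `I(X_S;Ỹ|X_{S^c})`. -/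
noncomputable def infoDen {𝒴 : Type} [Fintype 𝒴] [DecidableEq 𝒴] (W : Bool → 𝒴 → ℝ)
    (q : ℕ) (A B : Finset (Fin q)) : ℝ :=
  ∑ x : Fin q → Bool, ∑ yt : Fin (2^q) → 𝒴,
    ((2:ℝ)^q)⁻¹ * superCh W q x yt * Real.log (condOut W q A x yt / condOut W q B x yt)

/-- Same with logarithm base 2 (information measured in bits). -/
noncomputable def infoDen2 {𝒴 : Type} [Fintype 𝒴] [DecidableEq 𝒴] (W : Bool → 𝒴 → ℝ)
    (q : ℕ) (A B : Finset (Fin q)) : ℝ :=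
  ∑ x : Fin q → Bool, ∑ yt : Fin (2^q) → 𝒴,
    ((2:ℝ)^q)⁻¹ * superCh W q x yt * Real.logb 2 (condOut W q A x yt / condOut W q B x yt)

/-- Indicator of a proposition. -/
noncomputable def ind (P : Prop) : ℝ := @ite ℝ P (Classical.propDecidable P) 1 0

/-- Pmf of the random variable `T` under the pmf `p` on a finite space. -/
noncomputable def pmOf {Ω D : Type} [Fintype Ω] [DecidableEq D]
    (p : Ω → ℝ) (T : Ω → D) (d : D) : ℝ :=
  ∑ ω, if T ω = d then p ω else 0

/-- Shannon entropy (natural logarithm) of the random variable `T` under `p`. -/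
noncomputable def ent {Ω D : Type} [Fintype Ω] [Fintype D] [DecidableEq D]
    (p : Ω → ℝ) (T : Ω → D) : ℝ :=
  ∑ d, Real.negMulLog (pmOf p T d)

/-- Conditional mutual information `I(U;V|Wc) = H(U,Wc)+H(V,Wc)−H(U,V,Wc)−H(Wc)`
(natural logarithm). -/
noncomputable def condMI {Ω A B C : Type} [Fintype Ω] [Fintype A] [Fintype B] [Fintype C]
    [DecidableEq A] [DecidableEq B] [DecidableEq C]
    (p : Ω → ℝ) (U : Ω → A) (V : Ω → B) (Wc : Ω → C) : ℝ :=
  ent p (fun ω => (U ω, Wc ω)) + ent p (fun ω => (V ω, Wc ω))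
    - ent p (fun ω => (U ω, V ω, Wc ω)) - ent p Wc

/-- Output distribution of `N`-ary PPM:
`P_PPM^N(y) = (1/N) ∑_j P1(y_j) ∏_{h≠j} P0(y_h)`; for `N = 1` this is `P1`. -/
noncomputable def ppmOut {𝒴 : Type} [Fintype 𝒴] [DecidableEq 𝒴] (P0 P1 : 𝒴 → ℝ)
    (N : ℕ) (y : Fin N → 𝒴) : ℝ :=
  (N : ℝ)⁻¹ * ∑ j : Fin N, P1 (y j) * ∏ h ∈ univ.erase j, P0 (y h)

/-- Kullback–Leibler divergence (natural logarithm) between pmfs on a finite alphabet. -/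
noncomputable def KL {α : Type} [Fintype α] (P Q : α → ℝ) : ℝ :=
  ∑ z, P z * Real.log (P z / Q z)

lemma dIdx_eq_ofBits (q : ℕ) (x : Fin q → Bool) : dIdx q x = Nat.ofBits x := by
  induction q with
  | zero => simp [dIdx]
  | succ q ih =>
    rw [Nat.ofBits_succ, Function.comp_def, ← ih]
    simp only [dIdx, Fin.sum_univ_succ, Fin.val_zero, pow_zero, Fin.val_succ, Finset.mul_sum]
    rw [add_comm]
    congr 1
    · refine Finset.sum_congr rfl fun j _ => ?_
      split <;> simp [pow_succ, mul_comm]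
    · cases x 0 <;> simp

lemma testBit_dIdx {q : ℕ} (x : Fin q → Bool) (t : Fin q) : (dIdx q x).testBit t = x t := by
  rw [dIdx_eq_ofBits, Nat.testBit_ofBits_lt _ _ t.isLt]

lemma ppmPos_bijective (q : ℕ) : Function.Bijective (ppmPos q) := by
  rw [Fintype.bijective_iff_injective_and_card]
  refine ⟨fun x y h => funext fun t => ?_, by simp⟩
  rw [← testBit_dIdx x t, ← testBit_dIdx y t, show dIdx q x = dIdx q y from congrArg Fin.val h]

/-- Two inputs agree on the bits from level `k` on iff their positions lie in the same block of
length `2 ^ k`. -/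
lemma agree_iff_div_eq {q : ℕ} (k : ℕ) (x y : Fin q → Bool) :
    (∀ t : Fin q, k ≤ t → x t = y t) ↔ dIdx q x / 2 ^ k = dIdx q y / 2 ^ k := by
  rw [← Nat.shiftRight_eq_div_pow, ← Nat.shiftRight_eq_div_pow]
  constructor
  · intro h
    refine Nat.eq_of_testBit_eq fun s => ?_
    rw [Nat.testBit_shiftRight, Nat.testBit_shiftRight]
    by_cases hs : k + s < q
    · have := h ⟨k + s, hs⟩ (Nat.le_add_right k s)
      rwa [← testBit_dIdx x, ← testBit_dIdx y] at this
    · have hle : 2 ^ q ≤ 2 ^ (k + s) := Nat.pow_le_pow_right (by norm_num) (not_lt.mp hs)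
      rw [Nat.testBit_lt_two_pow ((dIdx_lt q x).trans_le hle),
        Nat.testBit_lt_two_pow ((dIdx_lt q y).trans_le hle)]
  · intro h t ht
    have := congrArg (fun n => n.testBit (t - k)) h
    simpa only [Nat.testBit_shiftRight, Nat.add_sub_cancel' ht, testBit_dIdx] using this

lemma block_lt {q k : ℕ} (hk : k ≤ q) (x : Fin q → Bool) (j : Fin (2 ^ k)) :
    2 ^ k * (dIdx q x / 2 ^ k) + j < 2 ^ q := by
  have hx : dIdx q x / 2 ^ k < 2 ^ (q - k) := by
    rw [Nat.div_lt_iff_lt_mul (by positivity), ← pow_add, Nat.sub_add_cancel hk]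
    exact dIdx_lt q x
  calc 2 ^ k * (dIdx q x / 2 ^ k) + j < 2 ^ k * (dIdx q x / 2 ^ k) + 2 ^ k := by
        have := j.isLt
        omega
    _ = 2 ^ k * (dIdx q x / 2 ^ k + 1) := by ring
    _ ≤ 2 ^ k * 2 ^ (q - k) := Nat.mul_le_mul_left _ hx
    _ = 2 ^ q := by rw [← pow_add, Nat.add_sub_cancel' hk]

/-- Enumeration of the block of length `2 ^ k` that contains the position of `x`. -/
def block {q k : ℕ} (hk : k ≤ q) (x : Fin q → Bool) (j : Fin (2 ^ k)) : Fin (2 ^ q) :=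
  ⟨2 ^ k * (dIdx q x / 2 ^ k) + j, block_lt hk x j⟩

lemma block_injective {q k : ℕ} (hk : k ≤ q) (x : Fin q → Bool) :
    Function.Injective (block hk x) := by
  intro j j' h
  have := congrArg Fin.val h
  simp only [block] at this
  exact Fin.ext (by omega)

lemma exists_block_eq {q k : ℕ} (hk : k ≤ q) (x : Fin q → Bool) (h : Fin (2 ^ q)) :
    (∃ j, block hk x j = h) ↔ (h : ℕ) / 2 ^ k = dIdx q x / 2 ^ k := by
  constructor
  · rintro ⟨j, rfl⟩
    simp [block, Nat.mul_add_div, Nat.div_eq_of_lt j.isLt]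
  · intro hh
    refine ⟨⟨h % 2 ^ k, Nat.mod_lt _ (by positivity)⟩, Fin.ext ?_⟩
    simp only [block]
    rw [← hh, Nat.div_add_mod]

lemma sum_agree {q k : ℕ} (hk : k ≤ q) (x : Fin q → Bool) (f : Fin (2 ^ q) → ℝ) :
    (∑ x' : Fin q → Bool, if ∀ t : Fin q, k ≤ t → x' t = x t then f (ppmPos q x') else 0)
      = ∑ j, f (block hk x j) := by
  simp only [agree_iff_div_eq]
  refine ((ppmPos_bijective q).sum_comp
    (fun h : Fin (2 ^ q) => if (h : ℕ) / 2 ^ k = dIdx q x / 2 ^ k then f h else 0)).trans ?_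
  rw [← Finset.sum_filter, ← Finset.sum_image (fun _ _ _ _ h => block_injective hk x h)]
  refine Finset.sum_congr (Finset.ext fun h => ?_) fun _ _ => rfl
  simp [← exists_block_eq hk x h]

/-- Marginalization of a product distribution onto the coordinates `e`. -/
lemma sum_prod_mul_comp {α β 𝒴 : Type} [Fintype α] [DecidableEq α] [Fintype β] [DecidableEq β]
    [Fintype 𝒴] {P : 𝒴 → ℝ} (hP : ∑ v, P v = 1) {e : α → β} (he : Function.Injective e)
    (F : (α → 𝒴) → ℝ) :
    ∑ y : β → 𝒴, (∏ h, P (y h)) * F (y ∘ e) = ∑ z : α → 𝒴, (∏ h, P (z h)) * F z := by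
  classical
  let ε : α ⊕ ↑(Set.range e)ᶜ ≃ β :=
    ((Equiv.ofInjective e he).sumCongr (Equiv.refl _)).trans (Equiv.Set.sumCompl (Set.range e))
  have hε (a : α) : ε (Sum.inl a) = e a := by simp [ε]
  rw [← Equiv.sum_comp ((Equiv.sumArrowEquivProdArrow α ↑(Set.range e)ᶜ 𝒴).symm.trans
    (Equiv.arrowCongr ε (Equiv.refl 𝒴))), Fintype.sum_prod_type]
  refine Finset.sum_congr rfl fun z _ => ?_
  have hrest : ∑ u : ↑(Set.range e)ᶜ → 𝒴, ∏ h, P (u h) = 1 := by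
    have := Finset.prod_univ_sum (fun _ : ↑(Set.range e)ᶜ => (univ : Finset 𝒴)) (fun _ v => P v)
    simpa [hP] using this.symm
  have hcomp (u : ↑(Set.range e)ᶜ → 𝒴) :
      (((Equiv.sumArrowEquivProdArrow α ↑(Set.range e)ᶜ 𝒴).symm.trans
        (Equiv.arrowCongr ε (Equiv.refl 𝒴))) (z, u)) = Sum.elim z u ∘ ε.symm := rfl
  have hz (u : ↑(Set.range e)ᶜ → 𝒴) : (Sum.elim z u ∘ ε.symm) ∘ e = z := by
    funext a
    simp [← hε a]
  have hprod (u : ↑(Set.range e)ᶜ → 𝒴) :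
      ∏ h, P ((Sum.elim z u ∘ ε.symm) h) = (∏ h, P (z h)) * ∏ h, P (u h) := by
    rw [← Equiv.prod_comp ε, Fintype.prod_sum_type]
    simp
  simp only [hcomp, hz, hprod]
  rw [← Finset.sum_mul, ← Finset.mul_sum, hrest, mul_one]

lemma ent_eq_neg_sum {Ω D : Type} [Fintype Ω] [Fintype D] [DecidableEq D]
    (p : Ω → ℝ) (T : Ω → D) : ent p T = -∑ ω, p ω * Real.log (pmOf p T (T ω)) := by
  have h (d : D) : Real.negMulLog (pmOf p T d)
      = -∑ ω, if T ω = d then p ω * Real.log (pmOf p T d) else 0 := by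
    rw [Real.negMulLog, neg_mul]
    nth_rewrite 1 [pmOf]
    rw [Finset.sum_mul]
    simp only [ite_mul, zero_mul]
  simp only [ent, h, Finset.sum_neg_distrib]
  rw [Finset.sum_comm]
  simp

section PPM

variable {𝒴 : Type}

/-- One pulse over background noise, written through the likelihood ratio. -/
lemma mul_prod_erase_eq {N : ℕ} {P0 : 𝒴 → ℝ} (hpos : ∀ v, 0 < P0 v) (P1 : 𝒴 → ℝ)
    (y : Fin N → 𝒴) (j : Fin N) :
    P1 (y j) * ∏ h ∈ univ.erase j, P0 (y h) = (∏ h, P0 (y h)) * (P1 (y j) / P0 (y j)) := by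
  rw [← Finset.mul_prod_erase univ (fun h => P0 (y h)) (Finset.mem_univ j)]
  field_simp [(hpos (y j)).ne']

variable [Fintype 𝒴]

lemma sum_prod_mul_ratio {N : ℕ} {P0 P1 : 𝒴 → ℝ} (hpos : ∀ v, 0 < P0 v) (h0 : ∑ v, P0 v = 1)
    (h1 : ∑ v, P1 v = 1) (j : Fin N) :
    ∑ y : Fin N → 𝒴, (∏ h, P0 (y h)) * (P1 (y j) / P0 (y j)) = 1 := by
  have := sum_prod_mul_comp h0 (e := fun _ : Unit => j) (fun _ _ _ => rfl)
    (fun z => P1 (z ()) / P0 (z ()))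
  simp only [Function.comp_apply] at this
  rw [this, ← Equiv.sum_comp (Equiv.funUnique Unit 𝒴).symm, ← h1]
  refine Finset.sum_congr rfl fun v _ => ?_
  simp [mul_div_cancel₀ _ (hpos v).ne']

variable [DecidableEq 𝒴]

lemma ppmOut_eq {N : ℕ} {P0 : 𝒴 → ℝ} (hpos : ∀ v, 0 < P0 v) (P1 : 𝒴 → ℝ) (y : Fin N → 𝒴) :
    ppmOut P0 P1 N y = (∏ h, P0 (y h)) * ((N : ℝ)⁻¹ * ∑ j, P1 (y j) / P0 (y j)) := by
  simp only [ppmOut, mul_prod_erase_eq hpos, ← Finset.mul_sum]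
  ring

lemma sum_ppmOut {N : ℕ} (hN : N ≠ 0) {P0 P1 : 𝒴 → ℝ} (hpos : ∀ v, 0 < P0 v)
    (h0 : ∑ v, P0 v = 1) (h1 : ∑ v, P1 v = 1) : ∑ y, ppmOut P0 P1 N y = 1 := by
  simp only [ppmOut, mul_prod_erase_eq hpos]
  rw [← Finset.mul_sum, Finset.sum_comm]
  simp [sum_prod_mul_ratio hpos h0 h1, hN]

/-- A function of the output that ignores the order of the slots has the same mean
whichever slot carries the pulse. -/
lemma sum_pulse_eq_sum_ppmOut {N : ℕ} (hN : N ≠ 0) {P0 : 𝒴 → ℝ} (hpos : ∀ v, 0 < P0 v)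
    (h0 : ∑ v, P0 v = 1) (P1 : 𝒴 → ℝ) {G : (Fin N → 𝒴) → ℝ}
    (hG : ∀ (σ : Equiv.Perm (Fin N)) z, G (z ∘ σ) = G z) (j : Fin N) :
    ∑ z : Fin N → 𝒴, (∏ h, P0 (z h)) * (P1 (z j) / P0 (z j) * G z)
      = ∑ z, ppmOut P0 P1 N z * G z := by
  have hsymm (j' : Fin N) : ∑ z : Fin N → 𝒴, (∏ h, P0 (z h)) * (P1 (z j') / P0 (z j') * G z)
      = ∑ z : Fin N → 𝒴, (∏ h, P0 (z h)) * (P1 (z j) / P0 (z j) * G z) := by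
    rw [← sum_prod_mul_comp h0 (Equiv.swap j j').injective
      (fun z => P1 (z j) / P0 (z j) * G z)]
    simp [hG]
  have hN' : (N : ℝ) ≠ 0 := Nat.cast_ne_zero.mpr hN
  have hsum : ∑ z, ppmOut P0 P1 N z * G z = (N : ℝ)⁻¹ * ∑ j' : Fin N, ∑ z : Fin N → 𝒴,
      (∏ h, P0 (z h)) * (P1 (z j') / P0 (z j') * G z) := by
    rw [Finset.sum_comm, Finset.mul_sum]
    refine Finset.sum_congr rfl fun z _ => ?_
    rw [ppmOut_eq hpos, ← Finset.mul_sum, ← Finset.sum_mul]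
    ring
  rw [hsum, Finset.sum_congr rfl fun j' _ => hsymm j']
  simp [hN']

lemma sum_ppmOut_mul_log {N : ℕ} (hN : N ≠ 0) {P0 P1 : 𝒴 → ℝ} (hpos : ∀ v, 0 < P0 v)
    (h0 : ∑ v, P0 v = 1) (h1 : ∑ v, P1 v = 1) {c : ℝ} (hc : c ≠ 0) :
    ∑ z, ppmOut P0 P1 N z * Real.log (c * ∑ j, P1 (z j) / P0 (z j))
      = Real.log (c * N) + KL (ppmOut P0 P1 N) (fun z => ∏ h, P0 (z h)) := by
  have hN' : (N : ℝ) ≠ 0 := Nat.cast_ne_zero.mpr hN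
  rw [← one_mul (Real.log (c * N)), ← sum_ppmOut hN hpos h0 h1, Finset.sum_mul, KL,
    ← Finset.sum_add_distrib]
  refine Finset.sum_congr rfl fun z _ => ?_
  by_cases hz : ppmOut P0 P1 N z = 0
  · simp [hz]
  have hP : ∏ h, P0 (z h) ≠ 0 := (Finset.prod_pos fun h _ => hpos (z h)).ne'
  have hratio : c * ∑ j, P1 (z j) / P0 (z j)
      = c * N * (ppmOut P0 P1 N z / ∏ h, P0 (z h)) := by
    rw [ppmOut_eq hpos]
    field_simp
  rw [hratio, Real.log_mul (mul_ne_zero hc hN') (div_ne_zero hz hP), mul_add]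

lemma superCh_eq {W : Bool → 𝒴 → ℝ} (hpos : ∀ v, 0 < W false v) (q : ℕ) (x : Fin q → Bool)
    (y : Fin (2 ^ q) → 𝒴) :
    superCh W q x y = (∏ h, W false (y h))
      * (W true (y (ppmPos q x)) / W false (y (ppmPos q x))) :=
  mul_prod_erase_eq hpos _ y _

lemma sum_superCh {W : Bool → 𝒴 → ℝ} (hW : ∀ x, IsPMF (W x)) (hpos : ∀ v, 0 < W false v)
    (q : ℕ) (x : Fin q → Bool) : ∑ y, superCh W q x y = 1 := by
  simp only [superCh_eq hpos]
  exact sum_prod_mul_ratio hpos (hW _).2 (hW _).2 _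

/-- Joint pmf of a uniform input and the output of the PPM super channel. -/
noncomputable def jointPMF (W : Bool → 𝒴 → ℝ) (q : ℕ)
    (ω : (Fin q → Bool) × (Fin (2 ^ q) → 𝒴)) : ℝ :=
  ((2 : ℝ) ^ q)⁻¹ * superCh W q ω.1 ω.2

lemma sum_jointPMF {W : Bool → 𝒴 → ℝ} (hW : ∀ x, IsPMF (W x)) (hpos : ∀ v, 0 < W false v)
    (q : ℕ) : ∑ ω, jointPMF W q ω = 1 := by
  simp [jointPMF, Fintype.sum_prod_type, ← Finset.mul_sum, sum_superCh hW hpos]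

lemma log_two_pow_ratio (q k : ℕ) :
    Real.log (((2 : ℝ) ^ q)⁻¹ * 2 ^ k) = ((k : ℝ) - q) * Real.log 2 := by
  rw [Real.log_mul (by positivity) (by positivity), Real.log_inv, Real.log_pow, Real.log_pow]
  ring

/-- Entropy of the input bits from level `k` on. -/
lemma ent_upper_bits {D : Type} [Fintype D] [DecidableEq D] {W : Bool → 𝒴 → ℝ}
    (hW : ∀ x, IsPMF (W x)) (hpos : ∀ v, 0 < W false v) {q k : ℕ} (hk : k ≤ q)
    (T : (Fin q → Bool) × (Fin (2 ^ q) → 𝒴) → D)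
    (hT : ∀ ω' ω, T ω' = T ω ↔ ∀ t : Fin q, k ≤ t → ω'.1 t = ω.1 t) :
    ent (jointPMF W q) T = ((q : ℝ) - k) * Real.log 2 := by
  have hpm (ω) : pmOf (jointPMF W q) T (T ω) = ((2 : ℝ) ^ q)⁻¹ * 2 ^ k := by
    have hagree := sum_agree hk ω.1 (fun _ => ((2 : ℝ) ^ q)⁻¹)
    simp only [Finset.sum_const, Finset.card_univ, Fintype.card_fin, nsmul_eq_mul] at hagree
    push_cast at hagree
    rw [mul_comm, ← hagree]
    simp only [pmOf, hT, Fintype.sum_prod_type]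
    refine Finset.sum_congr rfl fun x' _ => ?_
    split_ifs with h
    · simp [jointPMF, ← Finset.mul_sum, sum_superCh hW hpos]
    · simp
  simp only [ent_eq_neg_sum, hpm, ← Finset.sum_mul, sum_jointPMF hW hpos, log_two_pow_ratio]
  ring

/-- Entropy of the output together with the input bits from level `k` on. -/
lemma ent_output_upper_bits {D : Type} [Fintype D] [DecidableEq D] {W : Bool → 𝒴 → ℝ}
    (hW : ∀ x, IsPMF (W x)) (hpos : ∀ v, 0 < W false v) {q k : ℕ} (hk : k ≤ q)
    (T : (Fin q → Bool) × (Fin (2 ^ q) → 𝒴) → D)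
    (hT : ∀ ω' ω, T ω' = T ω ↔ ω'.2 = ω.2 ∧ ∀ t : Fin q, k ≤ t → ω'.1 t = ω.1 t) :
    ent (jointPMF W q) T = ((q : ℝ) - k) * Real.log 2
      - KL (ppmOut (W false) (W true) (2 ^ k)) (fun y => ∏ h, W false (y h))
      - ∑ ω, jointPMF W q ω * Real.log (∏ h, W false (ω.2 h)) := by
  let R (z : Fin (2 ^ k) → 𝒴) : ℝ := ((2 : ℝ) ^ q)⁻¹ * ∑ j, W true (z j) / W false (z j)
  have hpm (ω) : pmOf (jointPMF W q) T (T ω)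
      = R (ω.2 ∘ block hk ω.1) * ∏ h, W false (ω.2 h) := by
    have hagree := sum_agree hk ω.1 (fun h => W true (ω.2 h) / W false (ω.2 h))
    simp only [R, Function.comp_apply]
    rw [← hagree, Finset.mul_sum, Finset.sum_mul, pmOf, Fintype.sum_prod_type]
    refine Finset.sum_congr rfl fun x' _ => ?_
    simp only [hT, ite_and, Finset.sum_ite_eq', Finset.mem_univ, if_true, jointPMF,
      superCh_eq hpos]
    split_ifs
    · ring
    · simp
  have hprod (y : Fin (2 ^ q) → 𝒴) : 0 < ∏ h, W false (y h) :=
    Finset.prod_pos fun h _ => hpos (y h)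
  have hR (ω) (hω : jointPMF W q ω ≠ 0) : R (ω.2 ∘ block hk ω.1) ≠ 0 := by
    have hnn (j) : 0 ≤ W true (ω.2 (block hk ω.1 j)) / W false (ω.2 (block hk ω.1 j)) :=
      div_nonneg ((hW true).1 _) (hpos _).le
    obtain ⟨j, hj⟩ := (exists_block_eq hk ω.1 (ppmPos q ω.1)).mpr rfl
    refine mul_ne_zero (by positivity) (Finset.sum_pos' (fun j _ => hnn j)
      ⟨j, Finset.mem_univ j, lt_of_le_of_ne (hnn j) fun h => hω ?_⟩).ne'
    rw [hj] at h
    simp [jointPMF, superCh_eq hpos, ← h]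
  have hsplit (ω) : jointPMF W q ω * Real.log (pmOf (jointPMF W q) T (T ω))
      = jointPMF W q ω * Real.log (R (ω.2 ∘ block hk ω.1))
        + jointPMF W q ω * Real.log (∏ h, W false (ω.2 h)) := by
    by_cases hω : jointPMF W q ω = 0
    · simp [hω]
    · rw [hpm, Real.log_mul (hR ω hω) (hprod _).ne', mul_add]
  have hRperm (σ : Equiv.Perm (Fin (2 ^ k))) (z : Fin (2 ^ k) → 𝒴) :
      Real.log (R (z ∘ σ)) = Real.log (R z) := by
    simp only [R, Function.comp_apply]
    rw [Equiv.sum_comp σ fun j => W true (z j) / W false (z j)]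
  have hmean (x : Fin q → Bool) :
      ∑ y, superCh W q x y * Real.log (R (y ∘ block hk x))
        = ((k : ℝ) - q) * Real.log 2
          + KL (ppmOut (W false) (W true) (2 ^ k)) (fun y => ∏ h, W false (y h)) := by
    obtain ⟨j, hj⟩ := (exists_block_eq hk x (ppmPos q x)).mpr rfl
    have hlog := sum_ppmOut_mul_log (N := 2 ^ k) (by positivity) hpos (hW false).2 (hW true).2
      (c := ((2 : ℝ) ^ q)⁻¹) (by positivity)
    rw [Nat.cast_pow, Nat.cast_ofNat, log_two_pow_ratio] at hlog
    rw [← hlog]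
    change _ = ∑ z, ppmOut (W false) (W true) (2 ^ k) z * Real.log (R z)
    rw [← sum_pulse_eq_sum_ppmOut (by positivity) hpos (hW false).2 (W true) hRperm j,
      ← sum_prod_mul_comp (hW false).2 (block_injective hk x)]
    simp only [superCh_eq hpos, Function.comp_apply, hj, mul_assoc]
  have htotal : ∑ ω, jointPMF W q ω * Real.log (R (ω.2 ∘ block hk ω.1))
      = ((k : ℝ) - q) * Real.log 2
        + KL (ppmOut (W false) (W true) (2 ^ k)) (fun y => ∏ h, W false (y h)) := by
    simp only [Fintype.sum_prod_type, jointPMF, mul_assoc, ← Finset.mul_sum, hmean]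
    simp [← mul_add]
  rw [ent_eq_neg_sum, Finset.sum_congr rfl fun ω _ => hsplit ω, Finset.sum_add_distrib, htotal]
  ring

end PPM

lemma agree_ge_iff {q : ℕ} (i : Fin q) (x y : Fin q → Bool) :
    (∀ t : Fin q, (i : ℕ) ≤ t → x t = y t) ↔
      x i = y i ∧ (fun t : {t : Fin q // i < t} => x t) = fun t : {t : Fin q // i < t} => y t := by
  constructor
  · exact fun h => ⟨h i le_rfl, funext fun t => h t t.2.le⟩
  · rintro ⟨hi, h⟩ t ht
    rcases (Fin.le_def.mpr ht).eq_or_lt with rfl | hlt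
    · exact hi
    · exact congrFun h ⟨t, hlt⟩

lemma agree_gt_iff {q : ℕ} (i : Fin q) (x y : Fin q → Bool) :
    (∀ t : Fin q, (i : ℕ) + 1 ≤ t → x t = y t) ↔
      (fun t : {t : Fin q // i < t} => x t) = fun t : {t : Fin q // i < t} => y t :=
  ⟨fun h => funext fun t => h t t.2, fun h t ht => congrFun h ⟨t, ht⟩⟩

/-- The capacity of the `i`-th level of the MLC-PPM scheme satisfies the identity
`I(X_i;Ỹ|X_{i+1:q}) = D(P_PPM^{2^{i−1}} ‖ P0^{⊗2^{i−1}}) − D(P_PPM^{2^i} ‖ P0^{⊗2^i})`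
(here levels are 0-indexed: Lean level `i` is the paper's level `i+1`); in particular
it does not depend on the total number of levels `q`. -/
theorem stmt8 {𝒴 : Type} [Fintype 𝒴] [DecidableEq 𝒴]
    (W : Bool → 𝒴 → ℝ) (hW : ∀ x, IsPMF (W x)) (hpos : ∀ y, 0 < W false y)
    (q : ℕ) (i : Fin q) :
    condMI (fun ω : (Fin q → Bool) × (Fin (2^q) → 𝒴) => ((2:ℝ)^q)⁻¹ * superCh W q ω.1 ω.2)
      (fun ω => ω.1 i) (fun ω => ω.2) (fun ω => fun t : {t : Fin q // i < t} => ω.1 t)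
    = KL (ppmOut (W false) (W true) (2^(i:ℕ)))
        (fun y : Fin (2^(i:ℕ)) → 𝒴 => ∏ h, W false (y h))
      - KL (ppmOut (W false) (W true) (2^((i:ℕ)+1)))
        (fun y : Fin (2^((i:ℕ)+1)) → 𝒴 => ∏ h, W false (y h)) := by
  have hi : (i : ℕ) ≤ q := i.isLt.le
  have hi' : (i : ℕ) + 1 ≤ q := i.isLt
  change condMI (jointPMF W q) _ _ _ = _
  have hUC := ent_upper_bits hW hpos hi
    (fun ω => (ω.1 i, fun t : {t : Fin q // i < t} => ω.1 t))
    fun ω' ω => by rw [agree_ge_iff, Prod.mk.injEq]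
  have hC := ent_upper_bits hW hpos hi' (fun ω => fun t : {t : Fin q // i < t} => ω.1 t)
    fun ω' ω => by rw [agree_gt_iff]
  have hUVC := ent_output_upper_bits hW hpos hi
    (fun ω => (ω.1 i, ω.2, fun t : {t : Fin q // i < t} => ω.1 t))
    fun ω' ω => by rw [agree_ge_iff, Prod.mk.injEq, Prod.mk.injEq, and_left_comm]
  have hVC := ent_output_upper_bits hW hpos hi'
    (fun ω => (ω.2, fun t : {t : Fin q // i < t} => ω.1 t))
    fun ω' ω => by rw [agree_gt_iff, Prod.mk.injEq]
  rw [condMI, hUC, hC, hUVC, hVC]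
  ring
end

section
/- Let W_Y (Bob) and W_Z (Willie) be BI-DMCs on finite output alphabets with P_0 = W_Y(·|0), P_1 = W_Y(·|1), Q_0 = W_Z(·|0), Q_1 = W_Z(·|1), such that P_0 and Q_0 are everywhere positive, P_1 ≠ P_0, Q_1 ≠ Q_0, and W_Z is degraded with respect to W_Y (there is a channel W_{Z|Y} with W_Z(z|x) = Σ_y W_Y(y|x)W_{Z|Y}(z|y)). Fix ζ > 0 and δ > 0. Then for all sufficiently large n there exist M, K ∈ ℕ*, an encoder f: {1,…,M} × {1,…,K} → {0,1}^n, and a decoder g: 𝒴^n × {1,…,K} → {1,…,M} such that, with (Msg, Key) uniform and independent, Y^n the output of W_Y^{⊗n} and Z^n the output of W_Z^{⊗n} on input f(Msg, Key): (i) log M ≥ ( √(2/χ_2(Q_1‖Q_0))·D(P_1‖P_0) − ζ )·√(nδ); (ii) log K ≤ ζ·√(nδ); (iii) P( g(Y^n, Key) ≠ Msg ) ≤ ζ; and (iv) D( P_{Z^n} ‖ Q_0^{⊗n} ) ≤ δ + ζ, where P_{Z^n} is the pmf of Z^n. In other words, the covert capacity √(2/χ_2(Q_1‖Q_0))·D(P_1‖P_0)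 of the BI-DMC pair is achievable with negligible key throughput. -/
open Finset

/-- `n`-fold memoryless extension of the binary-input channel `W`. -/
noncomputable def prodCh {𝒵 : Type} (W : Bool → 𝒵 → ℝ) (n : ℕ)
    (z : Fin n → 𝒵) (x : Fin n → Bool) : ℝ :=
  ∏ t, W (x t) (z t)

/-- `χ_t(Q1‖Q0) = ∑_z (Q1(z)-Q0(z))^t / Q0(z)^{t-1}`. -/
noncomputable def chiDiv {𝒵 : Type} [Fintype 𝒵] (t : ℕ) (Q1 Q0 : 𝒵 → ℝ) : ℝ :=
  ∑ z, (Q1 z - Q0 z) ^ t / (Q0 z) ^ (t - 1)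

/-! ### Averages over i.i.d. codebooks -/

/-- Average of `F` over codebooks `c : ι → X` with i.i.d. entries of law `p`. -/
noncomputable def codeAvg {ι X : Type} [Fintype ι] [DecidableEq ι] [Fintype X] (p : X → ℝ)
    (F : (ι → X) → ℝ) : ℝ :=
  ∑ c : ι → X, (∏ i, p (c i)) * F c

section codeAvg

variable {ι X : Type} [Fintype ι] [DecidableEq ι] [Fintype X] {p : X → ℝ}

theorem codeAvg_sum {κ : Type} (s : Finset κ) (F : κ → (ι → X) → ℝ) :
    codeAvg p (fun c => ∑ j ∈ s, F j c) = ∑ j ∈ s, codeAvg p (F j) := by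
  simp only [codeAvg, mul_sum]
  exact sum_comm

theorem codeAvg_add (F G : (ι → X) → ℝ) :
    codeAvg p (fun c => F c + G c) = codeAvg p F + codeAvg p G := by
  simp only [codeAvg, mul_add, sum_add_distrib]

theorem codeAvg_const_mul (a : ℝ) (F : (ι → X) → ℝ) :
    codeAvg p (fun c => a * F c) = a * codeAvg p F := by
  simp only [codeAvg, mul_sum]
  exact sum_congr rfl fun c _ => by ring

theorem codeAvg_mono (hp : IsPMF p) {F G : (ι → X) → ℝ} (h : ∀ c, F c ≤ G c) :
    codeAvg p F ≤ codeAvg p G :=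
  sum_le_sum fun c _ => mul_le_mul_of_nonneg_left (h c) (prod_nonneg fun i _ => hp.1 (c i))

theorem codeAvg_one (hp : IsPMF p) : codeAvg p (fun _ : ι → X => 1) = 1 := by
  simp only [codeAvg, mul_one]
  rw [← Fintype.prod_sum (fun (_ : ι) x => p x)]
  simp [hp.2]

theorem codeAvg_apply (hp : IsPMF p) (h : X → ℝ) (i : ι) :
    codeAvg p (fun c => h (c i)) = ∑ x, p x * h x := by
  have key : ∀ c : ι → X, (∏ j, p (c j)) * h (c i)
      = ∏ j, (p (c j) * if j = i then h (c j) else 1) := fun c => by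
    rw [prod_mul_distrib]; simp
  have factor : ∀ j : ι, ∑ x, (p x * if j = i then h x else 1)
      = if j = i then ∑ x, p x * h x else 1 := fun j => by
    split_ifs <;> simp [hp.2]
  simp only [codeAvg, key]
  rw [← Fintype.prod_sum (fun (j : ι) x => p x * if j = i then h x else 1)]
  simp only [factor, prod_ite_eq', mem_univ, if_true]

theorem codeAvg_apply_mul_apply (hp : IsPMF p) (h k : X → ℝ) {i j : ι} (hij : i ≠ j) :
    codeAvg p (fun c => h (c i) * k (c j)) = (∑ x, p x * h x) * ∑ x, p x * k x := by
  have key : ∀ c : ι → X, (∏ l, p (c l)) * (h (c i) * k (c j))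
      = ∏ l, (p (c l) * ((if l = i then h (c l) else 1) * if l = j then k (c l) else 1)) :=
    fun c => by
      rw [prod_mul_distrib, prod_mul_distrib]; simp
  have factor : ∀ l : ι,
      ∑ x, (p x * ((if l = i then h x else 1) * if l = j then k x else 1))
      = (if l = i then ∑ x, p x * h x else 1) * if l = j then ∑ x, p x * k x else 1 :=
    fun l => by
      by_cases h1 : l = i
      · subst h1; simp [hij]
      · by_cases h2 : l = j
        · subst h2; simp [h1]
        · simp [h1, h2, hp.2]
  simp only [codeAvg, key]
  rw [← Fintype.prod_sum (fun (l : ι) x =>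
    p x * ((if l = i then h x else 1) * if l = j then k x else 1))]
  simp only [factor, prod_mul_distrib, prod_ite_eq', mem_univ, if_true]

theorem exists_le_codeAvg (hp : IsPMF p) (F : (ι → X) → ℝ) : ∃ c, F c ≤ codeAvg p F := by
  by_contra! hc
  have h1 := codeAvg_one (ι := ι) hp
  have hlt : codeAvg p (fun _ : ι → X => codeAvg p F * 1) < codeAvg p F := by
    conv_rhs => rw [codeAvg]
    rw [codeAvg]
    have hnn : ∀ c : ι → X, 0 ≤ ∏ i, p (c i) := fun c => prod_nonneg fun i _ => hp.1 (c i)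
    have hpos : ∃ c : ι → X, 0 < ∏ i, p (c i) := by
      by_contra! hz
      have : codeAvg p (fun _ : ι → X => 1) ≤ 0 :=
        sum_nonpos fun c _ => by simpa using hz c
      linarith
    obtain ⟨c₀, hc₀⟩ := hpos
    refine sum_lt_sum (fun c _ => ?_) ⟨c₀, mem_univ _, ?_⟩
    · exact mul_le_mul_of_nonneg_left (by simpa using (hc c).le) (hnn c)
    · exact mul_lt_mul_of_pos_left (by simpa using hc c₀) hc₀
  rw [codeAvg_const_mul, h1] at hlt
  linarith

end codeAvg

/-! ### Scalar inequalities -/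

theorem rpow_le_tangent {t a s : ℝ} (ht : 0 ≤ t) (ha : 0 < a) (hs0 : 0 ≤ s) (hs1 : s ≤ 1) :
    t ^ s ≤ a ^ s * (1 + s * (t / a - 1)) := by
  have h := Real.geom_mean_le_arith_mean2_weighted hs0 (sub_nonneg.2 hs1)
    (div_nonneg ht ha.le) zero_le_one (by ring)
  rw [Real.one_rpow, mul_one, Real.div_rpow ht ha.le, div_le_iff₀ (Real.rpow_pos_of_pos ha s)] at h
  linarith

theorem mul_log_add_div_le {v t a s : ℝ} (hv : 0 ≤ v) (ht : 0 ≤ t) (ha : 0 < a) (hs0 : 0 < s)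
    (hs1 : s ≤ 1) :
    v * Real.log ((v + t) / a) ≤ s⁻¹ * (v ^ (1 + s) * a ^ (-s)) + (v * t / a - v) := by
  rcases hv.eq_or_lt with rfl | hv
  · rw [Real.zero_rpow (by linarith)]; simp
  have hlog : Real.log ((v + t) / a) ≤ s⁻¹ * (((v + t) / a) ^ s - 1) := by
    have hpos : 0 < (v + t) / a := by positivity
    have h := Real.log_le_sub_one_of_pos (Real.rpow_pos_of_pos hpos s)
    rw [Real.log_rpow hpos] at h
    rwa [le_inv_mul_iff₀ hs0]
  have hsub : ((v + t) / a) ^ s ≤ (v / a) ^ s + (1 + s * (t / a - 1)) := by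
    rw [add_div]
    refine (Real.rpow_add_le_add_rpow (by positivity) (by positivity) hs0.le hs1).trans ?_
    have := rpow_le_tangent (t := t / a) (a := 1) (by positivity) one_pos hs0.le hs1
    simp only [Real.one_rpow, div_one, one_mul] at this
    linarith
  have hpow : v * (v / a) ^ s = v ^ (1 + s) * a ^ (-s) := by
    rw [Real.div_rpow hv.le ha.le, Real.rpow_add hv, Real.rpow_neg ha.le, Real.rpow_one]
    ring
  calc v * Real.log ((v + t) / a)
      ≤ v * (s⁻¹ * ((v / a) ^ s + (1 + s * (t / a - 1)) - 1)) := by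
        refine mul_le_mul_of_nonneg_left (hlog.trans ?_) hv.le
        gcongr
    _ = s⁻¹ * (v * (v / a) ^ s) + (v * t / a - v) := by field_simp; ring
    _ = _ := by rw [hpow]

theorem ind_nonneg (q : Prop) : 0 ≤ ind q := by
  unfold ind; split_ifs <;> norm_num

theorem ind_of_not {q : Prop} (h : ¬ q) : ind q = 0 := by
  unfold ind; rw [if_neg h]

theorem ind_of {q : Prop} (h : q) : ind q = 1 := by
  unfold ind; rw [if_pos h]

/-! ### One-shot random coding -/

section oneShot

variable {ι X Y Z : Type} [Fintype ι] [DecidableEq ι] [Fintype X] [Fintype Y] [Fintype Z]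
  {p : X → ℝ}

theorem codeAvg_mul_sum {κ : Type} (hp : IsPMF p) (h k : X → ℝ) {i : ι} (t : Finset κ)
    (e : κ → ι) (he : ∀ j ∈ t, e j ≠ i) :
    codeAvg p (fun c => h (c i) * ∑ j ∈ t, k (c (e j)))
      = (t.card : ℝ) * ((∑ x, p x * h x) * ∑ x, p x * k x) := by
  simp only [mul_sum t]
  rw [codeAvg_sum, sum_congr rfl fun j hj => codeAvg_apply_mul_apply hp h k (he j hj).symm]
  simp

/-- Soft covering: average divergence of the output law induced by an i.i.d. codebook. -/
theorem codeAvg_KL_le [Nonempty ι] (hp : IsPMF p) (V : X → Z → ℝ) (hV : ∀ x z, 0 ≤ V x z)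
    (Q : Z → ℝ) (hQ : ∀ z, 0 < Q z) (m : Z → ℝ) (hm : ∀ z, m z = ∑ x, p x * V x z)
    (hmpos : ∀ z, 0 < m z) {s : ℝ} (hs0 : 0 < s) (hs1 : s ≤ 1) :
    codeAvg p (fun c : ι → X => KL (fun z => (Fintype.card ι : ℝ)⁻¹ * ∑ i, V (c i) z) Q)
      ≤ KL m Q + s⁻¹ * ((Fintype.card ι : ℝ) ^ (-s) *
          ∑ z, ∑ x, p x * (V x z ^ (1 + s) * m z ^ (-s))) := by
  set N : ℝ := (Fintype.card ι : ℝ) with hN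
  have hNpos : 0 < N := by rw [hN]; exact_mod_cast Fintype.card_pos
  have hterm : ∀ z (c : ι → X),
      N⁻¹ * (∑ i, V (c i) z) * Real.log (N⁻¹ * (∑ i, V (c i) z) / Q z)
      ≤ ∑ i, N⁻¹ * (Real.log (m z / Q z) * V (c i) z
        + (s⁻¹ * (N * m z) ^ (-s) * V (c i) z ^ (1 + s)
        + ((N * m z)⁻¹ * (V (c i) z * ∑ j ∈ univ.erase i, V (c j) z)
          + (-1) * V (c i) z))) := by
    intro z c
    rw [mul_assoc, sum_mul, mul_sum]
    refine sum_le_sum fun i _ => mul_le_mul_of_nonneg_left ?_ (by positivity)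
    have hT : 0 ≤ ∑ j ∈ univ.erase i, V (c j) z := sum_nonneg fun j _ => hV _ _
    have hS : ∑ j, V (c j) z = V (c i) z + ∑ j ∈ univ.erase i, V (c j) z :=
      (add_sum_erase univ (fun j => V (c j) z) (mem_univ i)).symm
    rcases (hV (c i) z).eq_or_lt with h0 | hpos
    · rw [← h0, Real.zero_rpow (by linarith)]; simp
    have hsplit : Real.log (N⁻¹ * (∑ i, V (c i) z) / Q z)
        = Real.log (m z / Q z) + Real.log ((∑ i, V (c i) z) / (N * m z)) := by
      have := hmpos z
      have := hQ z
      have hSpos : 0 < ∑ i, V (c i) z := by rw [hS]; linarith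
      rw [← Real.log_mul (by positivity) (by positivity)]
      congr 1
      field_simp
    have h := mul_log_add_div_le (hV (c i) z) hT (mul_pos hNpos (hmpos z)) hs0 hs1
    rw [← hS] at h
    rw [hsplit, mul_add]
    calc _ ≤ V (c i) z * Real.log (m z / Q z) + _ := add_le_add le_rfl h
      _ = _ := by ring
  have havg : ∀ z, codeAvg p (fun c : ι → X =>
      N⁻¹ * (∑ i, V (c i) z) * Real.log (N⁻¹ * (∑ i, V (c i) z) / Q z))
      ≤ m z * Real.log (m z / Q z)
        + s⁻¹ * (N ^ (-s) * ∑ x, p x * (V x z ^ (1 + s) * m z ^ (-s))) := by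
    intro z
    refine (codeAvg_mono hp (hterm z)).trans ?_
    rw [codeAvg_sum]
    have hone : ∀ i : ι, codeAvg p (fun c : ι → X => N⁻¹ * (Real.log (m z / Q z) * V (c i) z
        + (s⁻¹ * (N * m z) ^ (-s) * V (c i) z ^ (1 + s)
        + ((N * m z)⁻¹ * (V (c i) z * ∑ j ∈ univ.erase i, V (c j) z)
          + (-1) * V (c i) z))))
        ≤ N⁻¹ * (m z * Real.log (m z / Q z)
        + s⁻¹ * (N ^ (-s) * ∑ x, p x * (V x z ^ (1 + s) * m z ^ (-s)))) := by
      intro i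
      rw [codeAvg_const_mul, codeAvg_add, codeAvg_add, codeAvg_add, codeAvg_const_mul,
        codeAvg_const_mul, codeAvg_const_mul, codeAvg_const_mul]
      have hprod := codeAvg_mul_sum hp (fun x => V x z) (fun x => V x z) (univ.erase i) id
        (i := i) (fun _ => ne_of_mem_erase)
      simp only [id] at hprod
      rw [hprod, codeAvg_apply hp (fun x => V x z) i, codeAvg_apply hp (fun x => V x z ^ (1 + s)) i, ← hm]
      refine mul_le_mul_of_nonneg_left ?_ (by positivity)
      have hcard : ((univ.erase i).card : ℝ) ≤ N := by
        rw [hN]; exact_mod_cast card_le_univ _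
      have h1 : (N * m z)⁻¹ * (((univ.erase i).card : ℝ) * (m z * m z)) ≤ m z := by
        have := hmpos z
        rw [inv_mul_le_iff₀ (by positivity)]
        nlinarith [mul_le_mul_of_nonneg_right hcard (mul_pos this this).le]
      have h2 : s⁻¹ * (N * m z) ^ (-s) * ∑ x, p x * V x z ^ (1 + s)
          = s⁻¹ * (N ^ (-s) * ∑ x, p x * (V x z ^ (1 + s) * m z ^ (-s))) := by
        rw [Real.mul_rpow hNpos.le (hmpos z).le]
        simp only [← mul_assoc, ← sum_mul]
        ring
      rw [h2]
      linarith
    refine (sum_le_sum fun i _ => hone i).trans_eq ?_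
    rw [sum_const, card_univ, nsmul_eq_mul, ← hN, ← mul_assoc, mul_inv_cancel₀ hNpos.ne', one_mul]
  simp only [KL]
  rw [codeAvg_sum]
  refine (sum_le_sum fun z _ => havg z).trans_eq ?_
  rw [sum_add_distrib, mul_sum, mul_sum]

/-- A maximum-likelihood decision errs only when another codeword is at least as likely. -/
theorem mul_ind_le {M : ℕ} {q : Fin M → ℝ} (hq : ∀ w, 0 ≤ q w) {d w : Fin M}
    (hd : ∀ w', q w' ≤ q d) {s : ℝ} (hs0 : 0 < s) :
    q w * ind (d ≠ w) ≤ q w ^ (1 - s) * (∑ w' ∈ univ.erase w, q w') ^ s := by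
  have hT : 0 ≤ ∑ w' ∈ univ.erase w, q w' := sum_nonneg fun _ _ => hq _
  by_cases h : d = w
  · rw [ind_of_not (not_not.2 h), mul_zero]
    exact mul_nonneg (Real.rpow_nonneg (hq w) _) (Real.rpow_nonneg hT _)
  · rw [ind_of h, mul_one]
    have hle : q w ≤ ∑ w' ∈ univ.erase w, q w' :=
      (hd w).trans (single_le_sum (f := q) (fun _ _ => hq _) (mem_erase.2 ⟨h, mem_univ d⟩))
    calc q w = q w ^ (1 - s) * q w ^ s := by
          rw [← Real.rpow_add' (hq w) (by simp), sub_add_cancel, Real.rpow_one]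
      _ ≤ _ := mul_le_mul_of_nonneg_left (Real.rpow_le_rpow (hq w) hle hs0.le)
          (Real.rpow_nonneg (hq w) _)

/-- Average error probability of maximum-likelihood decoding of an i.i.d. codebook. -/
theorem codeAvg_error_le {M K : ℕ} (hM : 1 ≤ M) (hK : 1 ≤ K) (hp : IsPMF p) (W : X → Y → ℝ)
    (hW : ∀ x y, 0 ≤ W x y) (m : Y → ℝ) (hm : ∀ y, m y = ∑ x, p x * W x y)
    (hmpos : ∀ y, 0 < m y) {s : ℝ} (hs0 : 0 < s) (hs1 : s ≤ 1)
    (g : (Fin M × Fin K → X) → Y → Fin K → Fin M)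
    (hg : ∀ (c : Fin M × Fin K → X) y k w, W (c (w, k)) y ≤ W (c (g c y k, k)) y) :
    codeAvg p (fun c : Fin M × Fin K → X => ((M : ℝ) * K)⁻¹ * ∑ w, ∑ k, ∑ y,
        W (c (w, k)) y * ind (g c y k ≠ w))
      ≤ (M : ℝ) ^ s * ∑ y, ∑ x, p x * (W x y ^ (1 - s) * m y ^ s) := by
  have hMpos : (0 : ℝ) < M := by exact_mod_cast hM
  have hKpos : (0 : ℝ) < K := by exact_mod_cast hK
  have hone : ∀ (w : Fin M) (k : Fin K) (y : Y),
      codeAvg p (fun c : Fin M × Fin K → X => W (c (w, k)) y * ind (g c y k ≠ w))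
      ≤ (M : ℝ) ^ s * ∑ x, p x * (W x y ^ (1 - s) * m y ^ s) := by
    intro w k y
    have hapos : 0 < (M : ℝ) * m y := mul_pos hMpos (hmpos y)
    have hpt : ∀ c : Fin M × Fin K → X, W (c (w, k)) y * ind (g c y k ≠ w)
        ≤ ((M : ℝ) * m y) ^ s * ((1 - s) * W (c (w, k)) y ^ (1 - s)
          + s * ((M : ℝ) * m y)⁻¹ *
            (W (c (w, k)) y ^ (1 - s) * ∑ w' ∈ univ.erase w, W (c (w', k)) y)) := by
      intro c
      refine (mul_ind_le (q := fun w => W (c (w, k)) y) (fun _ => hW _ _)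
        (fun w' => hg c y k w') hs0).trans ?_
      have hT : 0 ≤ ∑ w' ∈ univ.erase w, W (c (w', k)) y := sum_nonneg fun _ _ => hW _ _
      refine (mul_le_mul_of_nonneg_left (rpow_le_tangent hT hapos hs0.le hs1)
        (Real.rpow_nonneg (hW _ _) _)).trans_eq ?_
      ring
    refine (codeAvg_mono hp hpt).trans ?_
    rw [codeAvg_const_mul, codeAvg_add, codeAvg_const_mul, codeAvg_const_mul,
      codeAvg_apply hp (fun x => W x y ^ (1 - s)) (w, k),
      codeAvg_mul_sum hp (fun x => W x y ^ (1 - s)) (fun x => W x y) (univ.erase w)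
        (fun w' => (w', k)) (fun w' hw' h => ne_of_mem_erase hw' (congrArg Prod.fst h)), ← hm]
    have hA : 0 ≤ ∑ x, p x * W x y ^ (1 - s) :=
      sum_nonneg fun x _ => mul_nonneg (hp.1 x) (Real.rpow_nonneg (hW _ _) _)
    have hcard : ((univ.erase w).card : ℝ) ≤ M := by
      exact_mod_cast (card_le_univ (univ.erase w)).trans_eq (Fintype.card_fin M)
    have hratio : ((M : ℝ) * m y)⁻¹ * (((univ.erase w).card : ℝ) *
        ((∑ x, p x * W x y ^ (1 - s)) * m y)) ≤ ∑ x, p x * W x y ^ (1 - s) := by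
      rw [inv_mul_le_iff₀ hapos]
      nlinarith [mul_le_mul_of_nonneg_right hcard (mul_nonneg hA (hmpos y).le)]
    have hrhs : (M : ℝ) ^ s * ∑ x, p x * (W x y ^ (1 - s) * m y ^ s)
        = ((M : ℝ) * m y) ^ s * ∑ x, p x * W x y ^ (1 - s) := by
      rw [Real.mul_rpow hMpos.le (hmpos y).le]
      simp only [← mul_assoc, ← sum_mul]
      ring
    rw [hrhs]
    refine mul_le_mul_of_nonneg_left ?_ (Real.rpow_nonneg hapos.le _)
    rw [mul_assoc s]
    nlinarith [mul_le_mul_of_nonneg_left hratio hs0.le]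
  rw [codeAvg_const_mul, inv_mul_le_iff₀ (by positivity), codeAvg_sum]
  simp only [codeAvg_sum]
  refine (sum_le_sum fun w _ => sum_le_sum fun k _ => sum_le_sum fun y _ => hone w k y).trans_eq ?_
  rw [← mul_sum]
  simp
  ring

/-- One-shot random coding bound for reliability and output approximation simultaneously. -/
theorem exists_code {M K : ℕ} (hM : 1 ≤ M) (hK : 1 ≤ K) (hp : IsPMF p)
    (W : X → Y → ℝ) (hW : ∀ x y, 0 ≤ W x y) (V : X → Z → ℝ) (hV : ∀ x z, 0 ≤ V x z)
    (mY : Y → ℝ) (hmY : ∀ y, mY y = ∑ x, p x * W x y) (hmYpos : ∀ y, 0 < mY y)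
    (mZ : Z → ℝ) (hmZ : ∀ z, mZ z = ∑ x, p x * V x z) (hmZpos : ∀ z, 0 < mZ z)
    (Q : Z → ℝ) (hQ : ∀ z, 0 < Q z) {s : ℝ} (hs0 : 0 < s) (hs1 : s ≤ 1)
    {l : ℝ} (hl : 0 ≤ l) :
    ∃ (f : Fin M → Fin K → X) (g : Y → Fin K → Fin M),
      KL (fun z => ((M : ℝ) * K)⁻¹ * ∑ w, ∑ k, V (f w k) z) Q
        + l * (((M : ℝ) * K)⁻¹ * ∑ w, ∑ k, ∑ y, W (f w k) y * ind (g y k ≠ w))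
      ≤ KL mZ Q + s⁻¹ * (((M : ℝ) * K) ^ (-s) *
          ∑ z, ∑ x, p x * (V x z ^ (1 + s) * mZ z ^ (-s)))
        + l * ((M : ℝ) ^ s * ∑ y, ∑ x, p x * (W x y ^ (1 - s) * mY y ^ s)) := by
  have : Nonempty (Fin M) := ⟨⟨0, hM⟩⟩
  have : Nonempty (Fin K) := ⟨⟨0, hK⟩⟩
  choose g hg using fun (c : Fin M × Fin K → X) (y : Y) (k : Fin K) =>
    Finite.exists_max (fun w => W (c (w, k)) y)
  obtain ⟨c, hc⟩ := exists_le_codeAvg hp (fun c : Fin M × Fin K → X =>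
    KL (fun z => (Fintype.card (Fin M × Fin K) : ℝ)⁻¹ * ∑ i, V (c i) z) Q
      + l * (((M : ℝ) * K)⁻¹ * ∑ w, ∑ k, ∑ y, W (c (w, k)) y * ind (g c y k ≠ w)))
  refine ⟨fun w k => c (w, k), g c, ?_⟩
  rw [codeAvg_add, codeAvg_const_mul] at hc
  have h1 := codeAvg_KL_le (ι := Fin M × Fin K) hp V hV Q hQ mZ hmZ hmZpos hs0 hs1
  have h2 := codeAvg_error_le hM hK hp W hW mY hmY hmYpos hs0 hs1 g hg
  have hcard : (Fintype.card (Fin M × Fin K) : ℝ) = (M : ℝ) * K := by simp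
  simp only [hcard, Fintype.sum_prod_type] at hc h1
  exact hc.trans (add_le_add h1 (mul_le_mul_of_nonneg_left h2 hl))

end oneShot

/-! ### Memoryless extensions -/

theorem sum_sum_prod_eq_pow {A B : Type} [Fintype A] [Fintype B] (F : A → B → ℝ) (n : ℕ) :
    ∑ b : Fin n → B, ∑ a : Fin n → A, ∏ t, F (a t) (b t) = (∑ b, ∑ a, F a b) ^ n := by
  rw [Fintype.sum_pow]
  refine sum_congr rfl fun b _ => ?_
  rw [Fintype.prod_sum (fun (t : Fin n) a => F a (b t))]

theorem isPMF_prod {A : Type} [Fintype A] {p : A → ℝ} (hp : IsPMF p) (n : ℕ) :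
    IsPMF (fun a : Fin n → A => ∏ t, p (a t)) :=
  ⟨fun a => prod_nonneg fun t _ => hp.1 (a t), by rw [← Fintype.sum_pow, hp.2, one_pow]⟩

theorem KL_prod {A : Type} [Fintype A] {m q : A → ℝ} (hm : IsPMF m) (hmpos : ∀ a, 0 < m a)
    (hq : ∀ a, 0 < q a) (n : ℕ) :
    KL (fun a : Fin n → A => ∏ t, m (a t)) (fun a => ∏ t, q (a t)) = n * KL m q := by
  have h : ∀ a : Fin n → A, (∏ t, m (a t)) * Real.log ((∏ t, m (a t)) / ∏ t, q (a t))
      = ∑ t, (∏ t, m (a t)) * Real.log (m (a t) / q (a t)) := fun a => by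
    rw [← prod_div_distrib, Real.log_prod fun t _ => (div_pos (hmpos _) (hq _)).ne', mul_sum]
  simp only [KL, h]
  rw [sum_comm]
  have h' : ∀ t : Fin n, ∑ a : Fin n → A, (∏ t, m (a t)) * Real.log (m (a t) / q (a t))
      = ∑ a, m a * Real.log (m a / q a) := fun t =>
    codeAvg_apply hm (fun a => Real.log (m a / q a)) t
  simp [h']

theorem tensor_rpow {A : Type} [Fintype A] (b : Bool → ℝ) (W : Bool → A → ℝ)
    (hW : ∀ x a, 0 ≤ W x a) (m : A → ℝ) (hm : ∀ a, 0 ≤ m a) (u v : ℝ) (n : ℕ) :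
    ∑ a : Fin n → A, ∑ x : Fin n → Bool,
        (∏ t, b (x t)) * (prodCh W n a x ^ u * (∏ t, m (a t)) ^ v)
      = (∑ a, ∑ x, b x * (W x a ^ u * m a ^ v)) ^ n := by
  rw [← sum_sum_prod_eq_pow (fun x a => b x * (W x a ^ u * m a ^ v))]
  refine sum_congr rfl fun a _ => sum_congr rfl fun x _ => ?_
  rw [prod_mul_distrib, prod_mul_distrib, Real.finsetProd_rpow _ _ (fun t _ => hW _ _),
    Real.finsetProd_rpow _ _ (fun t _ => hm _), prodCh]

/-! ### Single-letter estimates -/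

/-- Law of the input bit with `P(1) = α`. -/
def bern (α : ℝ) (x : Bool) : ℝ := if x then α else 1 - α

theorem isPMF_bern {α : ℝ} (h0 : 0 ≤ α) (h1 : α ≤ 1) : IsPMF (bern α) :=
  ⟨fun x => by cases x <;> simp [bern, h0, h1], by simp [bern]⟩

/-- Output law of the channel `W` with input law `bern α`. -/
def mix {A : Type} (W : Bool → A → ℝ) (α : ℝ) (a : A) : ℝ := (1 - α) * W false a + α * W true a

section singleLetter

variable {A : Type} {W : Bool → A → ℝ} {α : ℝ}

theorem mix_eq_sum (a : A) : mix W α a = ∑ x, bern α x * W x a := by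
  simp [mix, bern, add_comm]

theorem mix_ge (hW : ∀ x a, 0 ≤ W x a) (h0 : 0 ≤ α) (a : A) : (1 - α) * W false a ≤ mix W α a := by
  have := mul_nonneg h0 (hW true a)
  simp only [mix]; linarith

theorem mix_pos (hW : ∀ x a, 0 ≤ W x a) (hpos : ∀ a, 0 < W false a) (h0 : 0 ≤ α)
    (h1 : α ≤ 1 / 2) (a : A) : 0 < mix W α a :=
  (mul_pos (by linarith) (hpos a)).trans_le (mix_ge hW h0 a)

theorem prod_mix_eq_sum (n : ℕ) (a : Fin n → A) :
    ∏ t, mix W α (a t) = ∑ x : Fin n → Bool, (∏ t, bern α (x t)) * prodCh W n a x := by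
  simp only [mix_eq_sum, prodCh, ← prod_mul_distrib]
  rw [Fintype.prod_sum (fun (t : Fin n) x => bern α x * W x (a t))]

variable [Fintype A]

theorem isPMF_mix (hW : ∀ x, IsPMF (W x)) (h0 : 0 ≤ α) (h1 : α ≤ 1) : IsPMF (mix W α) := by
  refine ⟨fun a => ?_, ?_⟩
  · exact add_nonneg (mul_nonneg (by linarith) ((hW _).1 a)) (mul_nonneg h0 ((hW _).1 a))
  · simp only [mix, sum_add_distrib, ← mul_sum, (hW _).2]; ring

/-- The moment `∑ P₁ (P₁/P₀)^u`. -/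
noncomputable def tilt (W : Bool → A → ℝ) (u : ℝ) : ℝ :=
  ∑ a, W true a * Real.exp (u * Real.log (W true a / W false a))

theorem rpow_mul_rpow_eq_tilt {v q u : ℝ} (hv : 0 ≤ v) (hq : 0 < q) (hu : 1 + u ≠ 0) :
    v ^ (1 + u) * q ^ (-u) = v * Real.exp (u * Real.log (v / q)) := by
  rcases hv.eq_or_lt with rfl | hv
  · rw [Real.zero_rpow hu]; simp
  rw [Real.log_div hv.ne' hq.ne', Real.rpow_add hv, Real.rpow_one, Real.rpow_def_of_pos hv,
    Real.rpow_def_of_pos hq, mul_assoc, ← Real.exp_add]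
  ring_nf

theorem tilt_nonneg (hW : ∀ x a, 0 ≤ W x a) (u : ℝ) : 0 ≤ tilt W u :=
  sum_nonneg fun _ _ => mul_nonneg (hW _ _) (Real.exp_pos _).le

theorem exists_tilt_le (hW : ∀ x, IsPMF (W x)) {ε : ℝ} (hε : 0 < ε) :
    ∃ u₀ > 0, ∀ u, |u| ≤ u₀ → tilt W u ≤ 1 + u * KL (W true) (W false) + ε * |u| := by
  have hd : HasDerivAt (tilt W) (KL (W true) (W false)) 0 := by
    have h : ∀ a ∈ (univ : Finset A),
        HasDerivAt (fun u : ℝ => W true a * Real.exp (u * Real.log (W true a / W false a)))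
        (W true a * Real.log (W true a / W false a)) 0 := fun a _ => by
      have := (((hasDerivAt_id (0 : ℝ)).mul_const
        (Real.log (W true a / W false a))).exp).const_mul (W true a)
      simpa using this
    exact HasDerivAt.fun_sum h
  have h0 : tilt W 0 = 1 := by simp [tilt, (hW true).2]
  have hev := (hasDerivAt_iff_isLittleO.1 hd).def hε
  obtain ⟨r, hr, hball⟩ := Metric.eventually_nhds_iff.1 hev
  refine ⟨r / 2, by linarith, fun u hu => ?_⟩
  have h := hball (y := u) (by rw [Real.dist_eq, sub_zero]; linarith)
  simp only [h0, sub_zero, smul_eq_mul, Real.norm_eq_abs] at h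
  linarith [le_abs_self (tilt W u - 1 - u * KL (W true) (W false))]

theorem exists_covering_moment_le (hW : ∀ x, IsPMF (W x)) (hpos : ∀ a, 0 < W false a) {s : ℝ}
    (hs0 : 0 < s) (hs1 : s ≤ 1) :
    ∃ C : ℝ, 0 ≤ C ∧ ∀ α, 0 ≤ α → α ≤ 1 / 2 →
      ∑ a, ∑ x, bern α x * (W x a ^ (1 + s) * mix W α a ^ (-s))
        ≤ 1 + α * (tilt W s - 1) + C * α ^ 2 := by
  have hW0 : ∀ x a, 0 ≤ W x a := fun x a => (hW x).1 a
  set χ : ℝ := ∑ a, (W true a - W false a) ^ 2 / W false a with hχ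
  have hχ0 : 0 ≤ χ := sum_nonneg fun a _ => div_nonneg (sq_nonneg _) (hW0 _ _)
  have hG := tilt_nonneg hW0 s
  refine ⟨2 * χ + 2 * tilt W s, by positivity, fun α h0 h1 => ?_⟩
  have hfalse : ∑ a, W false a ^ (1 + s) * mix W α a ^ (-s) ≤ 1 + 2 * α ^ 2 * χ := by
    have hpt : ∀ a, W false a ^ (1 + s) * mix W α a ^ (-s)
        ≤ W false a + s * ((W false a - mix W α a)
          + 2 * α ^ 2 * ((W true a - W false a) ^ 2 / W false a)) := by
      intro a
      have hq := hpos a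
      have hm := mix_pos hW0 hpos h0 h1 a
      have hge := mix_ge hW0 h0 a
      have ht := rpow_le_tangent hq.le hm hs0.le hs1
      have hfrac : W false a * (W false a / mix W α a - 1)
          ≤ (W false a - mix W α a) + 2 * α ^ 2 * ((W true a - W false a) ^ 2 / W false a) := by
        have hinv : (mix W α a)⁻¹ ≤ 2 * (W false a)⁻¹ := by
          rw [← div_eq_mul_inv, inv_le_comm₀ hm (by positivity), inv_div]
          nlinarith
        have hid : W false a * (W false a / mix W α a - 1)
            = (W false a - mix W α a)
              + (α * (W true a - W false a)) ^ 2 * (mix W α a)⁻¹ := by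
          have : α * (W true a - W false a) = mix W α a - W false a := by
            simp only [mix]; ring
          rw [this]
          field_simp
          ring
        rw [hid]
        have := mul_le_mul_of_nonneg_left hinv (sq_nonneg (α * (W true a - W false a)))
        calc _ ≤ (W false a - mix W α a) + _ := add_le_add le_rfl this
          _ = _ := by ring
      calc W false a ^ (1 + s) * mix W α a ^ (-s)
          = W false a * (mix W α a ^ (-s) * W false a ^ s) := by
            rw [Real.rpow_add hq, Real.rpow_one]; ring
        _ ≤ W false a * (mix W α a ^ (-s) *
            (mix W α a ^ s * (1 + s * (W false a / mix W α a - 1)))) := by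
            gcongr
        _ = W false a + s * (W false a * (W false a / mix W α a - 1)) := by
            rw [← mul_assoc (mix W α a ^ (-s)), ← Real.rpow_add hm]; simp; ring
        _ ≤ _ := by gcongr
    refine (sum_le_sum fun a _ => hpt a).trans ?_
    rw [sum_add_distrib, ← mul_sum, sum_add_distrib, sum_sub_distrib, ← mul_sum, ← hχ,
      (hW false).2, (isPMF_mix hW h0 (by linarith)).2]
    nlinarith [mul_nonneg (sq_nonneg α) hχ0]
  have htrue : ∑ a, W true a ^ (1 + s) * mix W α a ^ (-s) ≤ (1 + 2 * α) * tilt W s := by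
    rw [tilt, mul_sum]
    refine sum_le_sum fun a _ => ?_
    have hq := hpos a
    have hm := mix_pos hW0 hpos h0 h1 a
    rw [← rpow_mul_rpow_eq_tilt (hW0 _ _) hq (by linarith)]
    have hα : (0 : ℝ) < 1 - α := by linarith
    have h2 : mix W α a ^ (-s) ≤ (1 + 2 * α) * W false a ^ (-s) := by
      calc mix W α a ^ (-s) ≤ ((1 - α) * W false a) ^ (-s) :=
            Real.rpow_le_rpow_of_nonpos (mul_pos hα hq) (mix_ge hW0 h0 a) (by linarith)
        _ = (1 - α) ^ (-s) * W false a ^ (-s) := Real.mul_rpow hα.le hq.le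
        _ ≤ _ := by
          gcongr
          calc (1 - α) ^ (-s) ≤ (1 - α) ^ (-1 : ℝ) :=
                Real.rpow_le_rpow_of_exponent_ge hα (by linarith) (by linarith)
            _ ≤ 1 + 2 * α := by
              rw [Real.rpow_neg_one, inv_le_iff_one_le_mul₀ hα]
              nlinarith
    calc _ ≤ W true a ^ (1 + s) * ((1 + 2 * α) * W false a ^ (-s)) :=
          mul_le_mul_of_nonneg_left h2 (Real.rpow_nonneg (hW0 _ _) _)
      _ = _ := by ring
  simp only [Fintype.sum_bool, bern, if_true, Bool.false_eq_true, if_false, sum_add_distrib,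
    ← mul_sum]
  nlinarith [mul_le_mul_of_nonneg_left hfalse (by linarith : (0 : ℝ) ≤ 1 - α),
    mul_le_mul_of_nonneg_left htrue h0, mul_nonneg h0 (mul_nonneg (sq_nonneg α) hχ0)]

theorem exists_reliability_moment_le (hW : ∀ x, IsPMF (W x)) (hpos : ∀ a, 0 < W false a) {s : ℝ}
    (hs0 : 0 < s) (hs1 : s < 1) :
    ∃ C : ℝ, 0 ≤ C ∧ ∀ α, 0 ≤ α → α ≤ 1 / 2 →
      ∑ a, ∑ x, bern α x * (W x a ^ (1 - s) * mix W α a ^ s)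
        ≤ 1 + α * (tilt W (-s) - 1) + C * α ^ 2 := by
  have hW0 : ∀ x a, 0 ≤ W x a := fun x a => (hW x).1 a
  set B : ℝ := ∑ a, W true a / W false a with hB
  have hB0 : 0 ≤ B := sum_nonneg fun a _ => div_nonneg (hW0 _ _) (hW0 _ _)
  have hG := tilt_nonneg hW0 (-s)
  refine ⟨B * tilt W (-s), by positivity, fun α h0 h1 => ?_⟩
  have hfalse : ∑ a, W false a ^ (1 - s) * mix W α a ^ s ≤ 1 := by
    calc _ ≤ ∑ a, ((1 - s) * W false a + s * mix W α a) := sum_le_sum fun a _ =>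
          Real.geom_mean_le_arith_mean2_weighted (by linarith) hs0.le (hW0 _ _)
            (mix_pos hW0 hpos h0 h1 a).le (by ring)
      _ = 1 := by
        rw [sum_add_distrib, ← mul_sum, ← mul_sum, (hW false).2,
          (isPMF_mix hW h0 (by linarith)).2]
        ring
  have htrue : ∑ a, W true a ^ (1 - s) * mix W α a ^ s ≤ (1 + α * B) * tilt W (-s) := by
    rw [tilt, mul_sum]
    refine sum_le_sum fun a _ => ?_
    have hq := hpos a
    have hm := mix_pos hW0 hpos h0 h1 a
    rw [← rpow_mul_rpow_eq_tilt (hW0 _ _) hq (by linarith), neg_neg, ← sub_eq_add_neg]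
    have hBa : W true a ≤ B * W false a := by
      rw [← div_le_iff₀ hq]
      exact single_le_sum (f := fun a => W true a / W false a)
        (fun a _ => div_nonneg (hW0 _ _) (hW0 _ _)) (mem_univ a)
    have hle : mix W α a ≤ (1 + α * B) * W false a := by
      simp only [mix]
      nlinarith [mul_le_mul_of_nonneg_left hBa h0, mul_nonneg h0 hq.le]
    have hone : 1 ≤ 1 + α * B := by nlinarith [mul_nonneg h0 hB0]
    have h2 : mix W α a ^ s ≤ (1 + α * B) * W false a ^ s := by
      calc mix W α a ^ s ≤ ((1 + α * B) * W false a) ^ s := Real.rpow_le_rpow hm.le hle hs0.le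
        _ = (1 + α * B) ^ s * W false a ^ s := Real.mul_rpow (by linarith) hq.le
        _ ≤ _ := by
          gcongr
          exact Real.rpow_le_self_of_one_le hone hs1.le
    calc _ ≤ W true a ^ (1 - s) * ((1 + α * B) * W false a ^ s) :=
          mul_le_mul_of_nonneg_left h2 (Real.rpow_nonneg (hW0 _ _) _)
      _ = _ := by ring
  simp only [Fintype.sum_bool, bern, if_true, Bool.false_eq_true, if_false, sum_add_distrib,
    ← mul_sum]
  nlinarith [mul_le_mul_of_nonneg_left hfalse (by linarith : (0 : ℝ) ≤ 1 - α),
    mul_le_mul_of_nonneg_left htrue h0]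

theorem one_add_mul_log_le {u : ℝ} (hu : |u| ≤ 1 / 2) :
    (1 + u) * Real.log (1 + u) ≤ u + u ^ 2 / 2 + 4 * |u| ^ 3 := by
  have h := Real.abs_log_sub_add_sum_range_le (x := -u) (by rw [abs_neg]; linarith) 2
  simp only [sum_range_succ, range_zero, sum_empty, abs_neg, sub_neg_eq_add] at h
  have h3 : 0 ≤ |u| ^ 3 := by positivity
  have h2 : |u| ^ 3 / (1 - |u|) ≤ 2 * |u| ^ 3 := by
    rw [div_le_iff₀ (by linarith)]
    nlinarith
  have hlog : Real.log (1 + u) ≤ u - u ^ 2 / 2 + 2 * |u| ^ 3 := by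
    have := (le_abs_self _).trans (h.trans h2)
    norm_num at this
    linarith
  have hu' := abs_le.1 hu
  have hcube : -u ^ 3 ≤ |u| ^ 3 := by rw [← abs_pow]; exact neg_le_abs _
  nlinarith [mul_le_mul_of_nonneg_left hlog (by linarith : 0 ≤ 1 + u),
    mul_le_mul_of_nonneg_right hu'.2 h3]

theorem exists_KL_mix_le (hW : ∀ x, IsPMF (W x)) (hpos : ∀ a, 0 < W false a) :
    ∃ C : ℝ, ∃ α₀ > 0, ∀ α, 0 ≤ α → α ≤ α₀ →
      KL (mix W α) (W false) ≤ α ^ 2 * chiDiv 2 (W true) (W false) / 2 + C * α ^ 3 := by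
  set r : A → ℝ := fun a => (W true a - W false a) / W false a with hr
  set B : ℝ := ∑ a, |r a| with hB
  have hB0 : 0 ≤ B := sum_nonneg fun a _ => abs_nonneg _
  refine ⟨4 * ∑ a, W false a * |r a| ^ 3, (2 * (B + 1))⁻¹, by positivity, fun α h0 h1 => ?_⟩
  have hpt : ∀ a, mix W α a * Real.log (mix W α a / W false a)
      ≤ α * (W true a - W false a) + α ^ 2 / 2 * ((W true a - W false a) ^ 2 / W false a ^ (2 - 1))
        + α ^ 3 * 4 * (W false a * |r a| ^ 3) := by
    intro a
    have hq := hpos a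
    have hra : |r a| ≤ B := single_le_sum (f := fun a => |r a|) (fun a _ => abs_nonneg _)
      (mem_univ a)
    have hu : |α * r a| ≤ 1 / 2 := by
      rw [abs_mul, abs_of_nonneg h0]
      calc α * |r a| ≤ (2 * (B + 1))⁻¹ * (B + 1) :=
            mul_le_mul h1 (by linarith) (abs_nonneg _) (by positivity)
        _ = 1 / 2 := by field_simp
    have hdiv : mix W α a / W false a = 1 + α * r a := by
      simp only [mix, hr]; field_simp; ring
    have hmul : mix W α a = W false a * (1 + α * r a) := by
      rw [← hdiv]; field_simp
    rw [hdiv, hmul, mul_assoc]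
    refine (mul_le_mul_of_nonneg_left (one_add_mul_log_le hu) hq.le).trans_eq ?_
    rw [abs_mul, abs_of_nonneg h0]
    have e1 : W true a - W false a = W false a * r a := by simp only [hr]; field_simp
    rw [e1]
    norm_num
    field_simp
  rw [KL]
  refine (sum_le_sum fun a _ => hpt a).trans_eq ?_
  rw [sum_add_distrib, sum_add_distrib, ← mul_sum, ← mul_sum, ← mul_sum, sum_sub_distrib,
    (hW _).2, (hW _).2, chiDiv]
  ring

theorem chiDiv_two_pos (hpos : ∀ a, 0 < W false a) (hne : W true ≠ W false) :
    0 < chiDiv 2 (W true) (W false) := by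
  obtain ⟨a, ha⟩ := Function.ne_iff.1 hne
  refine sum_pos' (fun a _ => div_nonneg (sq_nonneg _) (pow_nonneg (hpos a).le _))
    ⟨a, mem_univ a, div_pos (by have := sub_ne_zero.2 ha; positivity) (pow_pos (hpos a) _)⟩

end singleLetter

/-! ### Divergence -/

theorem sub_le_mul_log_div {p q : ℝ} (hp : 0 ≤ p) (hq : 0 < q) : p - q ≤ p * Real.log (p / q) := by
  rcases hp.eq_or_lt with rfl | hp
  · simp [hq.le]
  have h := mul_le_mul_of_nonneg_left (Real.one_sub_inv_le_log_of_pos (div_pos hp hq)) hp.le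
  refine le_trans (le_of_eq ?_) h
  field_simp

theorem KL_nonneg {A : Type} [Fintype A] {P Q : A → ℝ} (hP : IsPMF P) (hQ : IsPMF Q)
    (hQpos : ∀ a, 0 < Q a) : 0 ≤ KL P Q := by
  have h := sum_le_sum fun a (_ : a ∈ univ) => sub_le_mul_log_div (hP.1 a) (hQpos a)
  rw [sum_sub_distrib, hP.2, hQ.2, sub_self] at h
  exact h

theorem KL_pos {A : Type} [Fintype A] {P Q : A → ℝ} (hP : IsPMF P) (hQ : IsPMF Q)
    (hQpos : ∀ a, 0 < Q a) (hne : P ≠ Q) : 0 < KL P Q := by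
  obtain ⟨a, ha⟩ := Function.ne_iff.1 hne
  have h := sum_lt_sum (fun a (_ : a ∈ univ) => sub_le_mul_log_div (hP.1 a) (hQpos a))
    ⟨a, mem_univ a, ?_⟩
  · rw [sum_sub_distrib, hP.2, hQ.2, sub_self] at h
    exact h
  rcases (hP.1 a).eq_or_lt with h0 | hpos
  · rw [← h0]; simp [hQpos a]
  have hq := hQpos a
  have h1 := Real.log_lt_sub_one_of_pos (div_pos hq hpos)
    (by rw [ne_eq, div_eq_one_iff_eq hpos.ne']; exact fun h => ha h.symm)
  have h2 : Real.log (Q a / P a) = -Real.log (P a / Q a) := by rw [← Real.log_inv, inv_div]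
  rw [h2] at h1
  have h3 := mul_lt_mul_of_pos_left h1 hpos
  have h4 : P a * (Q a / P a - 1) = Q a - P a := by field_simp
  linarith

/-- Data processing for the divergence. -/
theorem KL_le_of_degraded {A B : Type} [Fintype A] [Fintype B] {P₁ P₀ : A → ℝ} {Q₁ Q₀ : B → ℝ}
    {V : A → B → ℝ} (hP₁ : IsPMF P₁) (hP₀ : ∀ a, 0 < P₀ a) (hQ₁ : IsPMF Q₁) (hQ₀ : ∀ b, 0 < Q₀ b)
    (hV : ∀ a, IsPMF (V a)) (h₁ : ∀ b, Q₁ b = ∑ a, P₁ a * V a b)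
    (h₀ : ∀ b, Q₀ b = ∑ a, P₀ a * V a b) : KL Q₁ Q₀ ≤ KL P₁ P₀ := by
  have hpt : ∀ a b, P₁ a * V a b - P₀ a * V a b * (Q₁ b / Q₀ b)
      ≤ P₁ a * V a b * Real.log (P₁ a / P₀ a) - P₁ a * V a b * Real.log (Q₁ b / Q₀ b) := by
    intro a b
    have hnn : 0 ≤ P₁ a * V a b := mul_nonneg (hP₁.1 a) ((hV a).1 b)
    have hp := hP₀ a
    have hq := hQ₀ b
    rcases hnn.eq_or_lt with h0 | hpos
    · rw [← h0]
      have : 0 ≤ P₀ a * V a b * (Q₁ b / Q₀ b) :=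
        mul_nonneg (mul_nonneg hp.le ((hV a).1 b)) (div_nonneg (hQ₁.1 b) hq.le)
      linarith
    have hp1 : 0 < P₁ a := (hP₁.1 a).lt_of_ne fun h => by rw [← h] at hpos; simp at hpos
    have hq1 : 0 < Q₁ b := by
      rw [h₁]
      exact hpos.trans_le (single_le_sum (f := fun a => P₁ a * V a b)
        (fun a _ => mul_nonneg (hP₁.1 a) ((hV a).1 b)) (mem_univ a))
    have h := mul_le_mul_of_nonneg_left (Real.one_sub_inv_le_log_of_pos
      (div_pos (div_pos hp1 hp) (div_pos hq1 hq))) hpos.le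
    rw [Real.log_div (div_pos hp1 hp).ne' (div_pos hq1 hq).ne'] at h
    have he : P₁ a * V a b * (1 - (P₁ a / P₀ a / (Q₁ b / Q₀ b))⁻¹)
        = P₁ a * V a b - P₀ a * V a b * (Q₁ b / Q₀ b) := by
      field_simp
    linarith
  have hsum := sum_le_sum fun b (_ : b ∈ univ) => sum_le_sum fun a (_ : a ∈ univ) => hpt a b
  simp only [sum_sub_distrib, ← sum_mul, ← h₁, ← h₀] at hsum
  have e1 : ∑ b, Q₀ b * (Q₁ b / Q₀ b) = 1 := by
    rw [← hQ₁.2]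
    exact sum_congr rfl fun b _ => mul_div_cancel₀ _ (hQ₀ b).ne'
  have e2 : ∑ b, ∑ a, P₁ a * V a b * Real.log (P₁ a / P₀ a) = KL P₁ P₀ := by
    rw [sum_comm, KL]
    refine sum_congr rfl fun a _ => ?_
    rw [← sum_mul, ← mul_sum, (hV a).2, mul_one]
  rw [e1, e2, hQ₁.2, sub_self] at hsum
  rw [KL]
  linarith

theorem isPMF_prodCh {A : Type} [Fintype A] {W : Bool → A → ℝ} (hW : ∀ x, IsPMF (W x)) (n : ℕ)
    (x : Fin n → Bool) : IsPMF (fun a => prodCh W n a x) :=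
  ⟨fun a => prod_nonneg fun t _ => (hW _).1 _, by
    simp only [prodCh]
    rw [← Fintype.prod_sum (fun (t : Fin n) a => W (x t) a)]
    simp [(hW _).2]⟩

theorem isPMF_codebook {A : Type} [Fintype A] {W : Bool → A → ℝ} (hW : ∀ x, IsPMF (W x))
    {n M K : ℕ} (hM : 1 ≤ M) (hK : 1 ≤ K) (f : Fin M → Fin K → Fin n → Bool) :
    IsPMF (fun a => ((M : ℝ) * K)⁻¹ * ∑ w, ∑ k, prodCh W n a (f w k)) := by
  have hMpos : (0 : ℝ) < M := by exact_mod_cast hM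
  have hKpos : (0 : ℝ) < K := by exact_mod_cast hK
  refine ⟨fun a => mul_nonneg (by positivity) (sum_nonneg fun w _ => sum_nonneg fun k _ =>
    (isPMF_prodCh hW n _).1 a), ?_⟩
  rw [← mul_sum, sum_comm]
  have h : ∀ w : Fin M, ∑ a : Fin n → A, ∑ k, prodCh W n a (f w k) = K := fun w => by
    rw [sum_comm, sum_congr rfl fun k _ => (isPMF_prodCh hW n (f w k)).2]
    simp
  simp only [h]
  simp
  field_simp

/-! ### Block codes -/

/-- Random coding bound for memoryless channels with i.i.d. `bern α` codewords. -/
theorem exists_block_code {𝒴 𝒵 : Type} [Fintype 𝒴] [Fintype 𝒵]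
    {WY : Bool → 𝒴 → ℝ} {WZ : Bool → 𝒵 → ℝ} (hWY : ∀ x, IsPMF (WY x)) (hWZ : ∀ x, IsPMF (WZ x))
    (hP0 : ∀ y, 0 < WY false y) (hQ0 : ∀ z, 0 < WZ false z) {n M K : ℕ} (hM : 1 ≤ M)
    (hK : 1 ≤ K) {α s l : ℝ} (h0 : 0 ≤ α) (h1 : α ≤ 1 / 2) (hs0 : 0 < s) (hs1 : s ≤ 1)
    (hl : 0 ≤ l) :
    ∃ (f : Fin M → Fin K → Fin n → Bool) (g : (Fin n → 𝒴) → Fin K → Fin M),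
      KL (fun z : Fin n → 𝒵 => ((M : ℝ) * K)⁻¹ * ∑ w, ∑ k, prodCh WZ n z (f w k))
          (fun z => prodCh WZ n z (fun _ => false))
        + l * (((M : ℝ) * K)⁻¹ * ∑ w, ∑ k, ∑ y,
            prodCh WY n y (f w k) * ind (g y k ≠ w))
      ≤ n * KL (mix WZ α) (WZ false) + s⁻¹ * (((M : ℝ) * K) ^ (-s) *
          (∑ z, ∑ x, bern α x * (WZ x z ^ (1 + s) * mix WZ α z ^ (-s))) ^ n)
        + l * ((M : ℝ) ^ s *
          (∑ y, ∑ x, bern α x * (WY x y ^ (1 - s) * mix WY α y ^ s)) ^ n) := by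
  have hY0 : ∀ x y, 0 ≤ WY x y := fun x y => (hWY x).1 y
  have hZ0 : ∀ x z, 0 ≤ WZ x z := fun x z => (hWZ x).1 z
  obtain ⟨f, g, h⟩ := exists_code hM hK (isPMF_prod (isPMF_bern h0 (by linarith)) n)
    (fun x y => prodCh WY n y x) (fun x y => (isPMF_prodCh hWY n x).1 y)
    (fun x z => prodCh WZ n z x) (fun x z => (isPMF_prodCh hWZ n x).1 z)
    (fun y => ∏ t, mix WY α (y t)) (prod_mix_eq_sum n)
    (fun y => prod_pos fun t _ => mix_pos hY0 hP0 h0 h1 _)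
    (fun z => ∏ t, mix WZ α (z t)) (prod_mix_eq_sum n)
    (fun z => prod_pos fun t _ => mix_pos hZ0 hQ0 h0 h1 _)
    (fun z => prodCh WZ n z (fun _ => false)) (fun z => prod_pos fun t _ => hQ0 _) hs0 hs1 hl
  refine ⟨f, g, h.trans_eq ?_⟩
  rw [tensor_rpow _ WZ hZ0 _ (fun z => (mix_pos hZ0 hQ0 h0 h1 z).le),
    tensor_rpow _ WY hY0 _ (fun y => (mix_pos hY0 hP0 h0 h1 y).le)]
  congr 2
  exact KL_prod (isPMF_mix hWZ h0 (by linarith)) (mix_pos hZ0 hQ0 h0 h1) hQ0 n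

theorem pow_le_exp_of_le_one_add {x y : ℝ} (hx : 0 ≤ x) (h : x ≤ 1 + y) (n : ℕ) :
    x ^ n ≤ Real.exp (n * y) := by
  rw [Real.exp_nat_mul]
  exact pow_le_pow_left₀ hx (h.trans (by linarith [Real.add_one_le_exp y])) n

theorem sum_bern_rpow_nonneg {A : Type} [Fintype A] {W : Bool → A → ℝ} (hW : ∀ x, IsPMF (W x))
    {α : ℝ} (h0 : 0 ≤ α) (h1 : α ≤ 1) (u v : ℝ) :
    0 ≤ ∑ a, ∑ x, bern α x * (W x a ^ u * mix W α a ^ v) :=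
  sum_nonneg fun a _ => sum_nonneg fun x _ => mul_nonneg ((isPMF_bern h0 h1).1 x)
    (mul_nonneg (Real.rpow_nonneg ((hW x).1 a) _)
      (Real.rpow_nonneg ((isPMF_mix hW h0 h1).1 a) _))

open Filter Topology in
/-- Achievability when `ζ` does not exceed the covert capacity. -/
theorem exists_covert_code {𝒴 𝒵 : Type} [Fintype 𝒴] [Fintype 𝒵]
    {WY : Bool → 𝒴 → ℝ} {WZ : Bool → 𝒵 → ℝ} (hWY : ∀ x, IsPMF (WY x)) (hWZ : ∀ x, IsPMF (WZ x))
    (hP0 : ∀ y, 0 < WY false y) (hQ0 : ∀ z, 0 < WZ false z)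
    (hχ : 0 < chiDiv 2 (WZ true) (WZ false))
    (hKL : KL (WZ true) (WZ false) ≤ KL (WY true) (WY false))
    {ζ δ : ℝ} (hζ : 0 < ζ) (hδ : 0 < δ)
    (hζle : ζ ≤ Real.sqrt (2 / chiDiv 2 (WZ true) (WZ false)) * KL (WY true) (WY false)) :
    ∃ N0 : ℕ, ∀ n, N0 ≤ n →
      ∃ (M K : ℕ) (_ : 1 ≤ M) (_ : 1 ≤ K)
        (f : Fin M → Fin K → Fin n → Bool) (g : (Fin n → 𝒴) → Fin K → Fin M),
        (Real.log M ≥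
          (Real.sqrt (2 / chiDiv 2 (WZ true) (WZ false)) * KL (WY true) (WY false) - ζ)
            * Real.sqrt (n * δ)) ∧
        (Real.log K ≤ ζ * Real.sqrt (n * δ)) ∧
        (((M : ℝ) * K)⁻¹ * ∑ w : Fin M, ∑ key : Fin K, ∑ y : Fin n → 𝒴,
            prodCh WY n y (f w key) * ind (g y key ≠ w) ≤ ζ) ∧
        KL (fun z : Fin n → 𝒵 => ((M : ℝ) * K)⁻¹ * ∑ w : Fin M, ∑ key : Fin K,
              prodCh WZ n z (f w key))
           (fun z => prodCh WZ n z (fun _ => false)) ≤ δ + ζ := by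
  set χ := chiDiv 2 (WZ true) (WZ false) with hχdef
  set DP := KL (WY true) (WY false) with hDP
  set DQ := KL (WZ true) (WZ false) with hDQ
  set c := Real.sqrt (2 / χ) with hc
  have hcpos : 0 < c := Real.sqrt_pos.2 (by positivity)
  have hcχ : c ^ 2 * χ = 2 := by
    rw [hc, Real.sq_sqrt (by positivity)]; field_simp
  obtain ⟨uY, huY, htY⟩ := exists_tilt_le hWY (ε := ζ / (4 * c)) (by positivity)
  obtain ⟨uZ, huZ, htZ⟩ := exists_tilt_le hWZ (ε := ζ / (4 * c)) (by positivity)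
  obtain ⟨s, hs0, hsY, hsZ, hs1⟩ : ∃ s : ℝ, 0 < s ∧ s ≤ uY ∧ s ≤ uZ ∧ s ≤ 1 / 2 :=
    ⟨min uY (min uZ (1 / 2)), by positivity, min_le_left _ _,
      (min_le_right _ _).trans (min_le_left _ _), (min_le_right _ _).trans (min_le_right _ _)⟩
  have htY := htY (-s) (by rwa [abs_neg, abs_of_pos hs0])
  have htZ := htZ s (by rwa [abs_of_pos hs0])
  rw [abs_neg, abs_of_pos hs0] at htY
  rw [abs_of_pos hs0] at htZ
  obtain ⟨CZ, hCZ, hcov⟩ := exists_covering_moment_le hWZ hQ0 hs0 (by linarith)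
  obtain ⟨CY, hCY, hrel⟩ := exists_reliability_moment_le hWY hP0 hs0 (by linarith)
  obtain ⟨C, α₀, hα₀, hdiv⟩ := exists_KL_mix_le hWZ hQ0
  set l := (δ + 1) / ζ with hl
  have hlpos : 0 < l := by positivity
  -- residual terms
  set R : ℕ → ℝ := fun n => Real.sqrt (n * δ) with hR
  set α : ℕ → ℝ := fun n => c * (δ / R n) with hα
  set E : ℕ → ℝ := fun n =>
    Real.exp ((CZ + CY) * (c ^ 2 * δ) + s * Real.log 2 - s * ζ / 4 * R n) with hE
  have hRtop : Tendsto R atTop atTop :=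
    Real.tendsto_sqrt_atTop.comp (tendsto_natCast_atTop_atTop.atTop_mul_const hδ)
  have hαlim : Tendsto α atTop (𝓝 0) := by
    simpa using (hRtop.const_div_atTop δ).const_mul c
  have hElim : Tendsto E atTop (𝓝 0) := by
    refine Real.tendsto_exp_atBot.comp ?_
    simp only [sub_eq_add_neg]
    exact tendsto_atBot_add_const_left _ _ (tendsto_neg_atTop_atBot.comp
      (hRtop.const_mul_atTop (by positivity)))
  have hηlim : Tendsto (fun n => C * (c ^ 2 * δ) * α n + (s⁻¹ + l) * E n) atTop (𝓝 0) := by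
    simpa using (hαlim.const_mul (C * (c ^ 2 * δ))).add (hElim.const_mul (s⁻¹ + l))
  have hev := (hηlim.eventually_le_const (lt_min hζ one_pos)).and
    ((hαlim.eventually_le_const (lt_min hα₀ (by norm_num : (0 : ℝ) < 1 / 2))).and
      (eventually_ge_atTop 1))
  obtain ⟨N0, hN0⟩ := eventually_atTop.1 hev
  refine ⟨N0, fun n hn => ?_⟩
  obtain ⟨hη, hαle, hn1⟩ := hN0 n hn
  have hnpos : (0 : ℝ) < n := by exact_mod_cast hn1
  have hRpos : 0 < R n := Real.sqrt_pos.2 (by positivity)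
  have hRsq : R n ^ 2 = n * δ := Real.sq_sqrt (by positivity)
  have hαpos : 0 < α n := by positivity
  have hnα : n * α n = c * R n := by
    simp only [hα]; field_simp; linarith
  have hnα2 : n * α n ^ 2 = c ^ 2 * δ := by
    rw [sq, ← mul_assoc, hnα]; simp only [hα]; field_simp
  have hα1 : α n ≤ 1 / 2 := hαle.trans (min_le_right _ _)
  -- code size
  set M : ℕ := ⌈Real.exp ((c * DP - ζ / 2) * R n)⌉₊ with hMdef
  set K : ℕ := ⌊Real.exp (ζ * R n)⌋₊ with hKdef
  have hM : 1 ≤ M := Nat.ceil_pos.2 (Real.exp_pos _)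
  have hexpK : 1 ≤ Real.exp (ζ * R n) := Real.one_le_exp (by positivity)
  have hexpM : 1 ≤ Real.exp ((c * DP - ζ / 2) * R n) :=
    Real.one_le_exp (mul_nonneg (by linarith) hRpos.le)
  have hK : 1 ≤ K := Nat.floor_pos.2 hexpK
  have hMpos : (0 : ℝ) < M := by exact_mod_cast hM
  have hKpos : (0 : ℝ) < K := by exact_mod_cast hK
  have hMge : Real.exp ((c * DP - ζ / 2) * R n) ≤ M := Nat.le_ceil _
  have hMle : (M : ℝ) ≤ Real.exp ((c * DP - ζ / 2) * R n + Real.log 2) := by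
    rw [Real.exp_add, Real.exp_log two_pos]
    linarith [Nat.ceil_lt_add_one (Real.exp_pos ((c * DP - ζ / 2) * R n)).le]
  have hKge : Real.exp (ζ * R n - Real.log 2) ≤ K := by
    rw [Real.exp_sub, Real.exp_log two_pos]
    have := Nat.lt_floor_add_one (Real.exp (ζ * R n))
    have h1K : (1 : ℝ) ≤ K := by exact_mod_cast hK
    linarith
  have hMKge : Real.exp ((c * DP + ζ / 2) * R n - Real.log 2) ≤ (M : ℝ) * K := by
    calc _ = Real.exp ((c * DP - ζ / 2) * R n) * Real.exp (ζ * R n - Real.log 2) := by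
          rw [← Real.exp_add]; ring_nf
      _ ≤ _ := mul_le_mul hMge hKge (Real.exp_pos _).le hMpos.le
  have hcε : c * (ζ / (4 * c)) = ζ / 4 := by field_simp
  -- the two vanishing terms
  have hcovE : ((M : ℝ) * K) ^ (-s) *
      (∑ z, ∑ x, bern (α n) x * (WZ x z ^ (1 + s) * mix WZ (α n) z ^ (-s))) ^ n ≤ E n := by
    have h1 : ((M : ℝ) * K) ^ (-s)
        ≤ Real.exp (((c * DP + ζ / 2) * R n - Real.log 2) * (-s)) := by
      rw [Real.exp_mul]
      exact Real.rpow_le_rpow_of_nonpos (Real.exp_pos _) hMKge (by linarith)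
    have h2 := pow_le_exp_of_le_one_add
      (sum_bern_rpow_nonneg hWZ hαpos.le (by linarith) (1 + s) (-s))
      ((hcov (α n) hαpos.le hα1).trans_eq (add_assoc _ _ _)) n
    refine (mul_le_mul h1 h2 (pow_nonneg (sum_bern_rpow_nonneg hWZ hαpos.le (by linarith) _ _) _)
      (Real.exp_pos _).le).trans ?_
    rw [← Real.exp_add]
    refine Real.exp_le_exp.2 ?_
    have h3 : n * (α n * (tilt WZ s - 1) + CZ * α n ^ 2)
        = c * R n * (tilt WZ s - 1) + CZ * (c ^ 2 * δ) := by
      rw [← hnα, ← hnα2]; ring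
    have h4 : c * R n * (tilt WZ s - 1) ≤ c * R n * (s * DP + ζ / (4 * c) * s) := by
      gcongr
      linarith [mul_le_mul_of_nonneg_left hKL hs0.le]
    have h5 : c * R n * (s * DP + ζ / (4 * c) * s) = s * R n * (c * DP + ζ / 4) := by
      rw [← hcε]; ring
    rw [h3]
    linarith [mul_nonneg hCY (mul_pos (pow_pos hcpos 2) hδ).le]
  have hrelE : (M : ℝ) ^ s *
      (∑ y, ∑ x, bern (α n) x * (WY x y ^ (1 - s) * mix WY (α n) y ^ s)) ^ n ≤ E n := by
    have h1 : (M : ℝ) ^ s ≤ Real.exp (((c * DP - ζ / 2) * R n + Real.log 2) * s) := by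
      rw [Real.exp_mul]
      exact Real.rpow_le_rpow hMpos.le hMle hs0.le
    have h2 := pow_le_exp_of_le_one_add
      (sum_bern_rpow_nonneg hWY hαpos.le (by linarith) (1 - s) s)
      ((hrel (α n) hαpos.le hα1).trans_eq (add_assoc _ _ _)) n
    refine (mul_le_mul h1 h2 (pow_nonneg (sum_bern_rpow_nonneg hWY hαpos.le (by linarith) _ _) _)
      (Real.exp_pos _).le).trans ?_
    rw [← Real.exp_add]
    refine Real.exp_le_exp.2 ?_
    have h3 : n * (α n * (tilt WY (-s) - 1) + CY * α n ^ 2)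
        = c * R n * (tilt WY (-s) - 1) + CY * (c ^ 2 * δ) := by
      rw [← hnα, ← hnα2]; ring
    have h4 : c * R n * (tilt WY (-s) - 1) ≤ c * R n * (-s * DP + ζ / (4 * c) * s) := by
      gcongr
      linarith
    have h5 : c * R n * (-s * DP + ζ / (4 * c) * s) = s * R n * (-(c * DP) + ζ / 4) := by
      rw [← hcε]; ring
    rw [h3]
    linarith [mul_nonneg hCZ (mul_pos (pow_pos hcpos 2) hδ).le]
  have hdivE : n * KL (mix WZ (α n)) (WZ false) ≤ δ + C * (c ^ 2 * δ) * α n := by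
    have h := mul_le_mul_of_nonneg_left
      (hdiv (α n) hαpos.le (hαle.trans (min_le_left _ _))) hnpos.le
    refine h.trans_eq ?_
    calc n * (α n ^ 2 * χ / 2 + C * α n ^ 3)
        = (n * α n ^ 2) * χ / 2 + C * (n * α n ^ 2) * α n := by ring
      _ = (c ^ 2 * χ) * δ / 2 + C * (c ^ 2 * δ) * α n := by rw [hnα2]; ring
      _ = _ := by rw [hcχ]; ring
  obtain ⟨f, g, hfg⟩ := exists_block_code hWY hWZ hP0 hQ0 (n := n) hM hK hαpos.le hα1 hs0
    (by linarith) hlpos.le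
  refine ⟨M, K, hM, hK, f, g, ?_, ?_, ?_⟩
  · have h := Real.log_le_log (Real.exp_pos _) hMge
    rw [Real.log_exp] at h
    refine le_trans ?_ h
    exact mul_le_mul_of_nonneg_right (by linarith) hRpos.le
  · have h := Real.log_le_log hKpos (Nat.floor_le (Real.exp_pos (ζ * R n)).le)
    rwa [Real.log_exp] at h
  have hKL0 := KL_nonneg (isPMF_codebook hWZ hM hK f) (isPMF_prodCh hWZ n (fun _ => false))
    (fun z => prod_pos fun t _ => hQ0 _)
  have herr0 : 0 ≤ ((M : ℝ) * K)⁻¹ * ∑ w, ∑ k, ∑ y,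
      prodCh WY n y (f w k) * ind (g y k ≠ w) :=
    mul_nonneg (by positivity) (sum_nonneg fun w _ => sum_nonneg fun k _ => sum_nonneg fun y _ =>
      mul_nonneg ((isPMF_prodCh hWY n _).1 y) (ind_nonneg _))
  have hcovE' := mul_le_mul_of_nonneg_left hcovE (inv_pos.2 hs0).le
  have hrelE' := mul_le_mul_of_nonneg_left hrelE hlpos.le
  have hη1 := hη.trans (min_le_left _ _)
  have hη2 := hη.trans (min_le_right _ _)
  constructor
  · have h : l * (((M : ℝ) * K)⁻¹ * ∑ w, ∑ k, ∑ y,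
        prodCh WY n y (f w k) * ind (g y k ≠ w)) ≤ l * ζ := by
      rw [show l * ζ = δ + 1 from div_mul_cancel₀ _ hζ.ne']
      linarith
    exact le_of_mul_le_mul_left h hlpos
  · linarith [mul_nonneg hlpos.le herr0]

/-- Theorem 1: when Willie's channel is degraded with respect to Bob's channel, for
every `ζ, δ > 0` and all large enough `n` there exist keyed codes of blocklength `n`
with `log M ≥ (√(2/χ₂(Q1‖Q0)) D(P1‖P0) − ζ)√(nδ)` message bits,
`log K ≤ ζ√(nδ)` key bits, error probability at most `ζ`, and
`D(P_{Z^n} ‖ Q0^{⊗n}) ≤ δ + ζ`: the covert capacity is achievable with negligible key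
throughput. -/
theorem stmt18 {𝒴 𝒵 : Type} [Fintype 𝒴] [Fintype 𝒵] [DecidableEq 𝒴] [DecidableEq 𝒵]
    (WY : Bool → 𝒴 → ℝ) (WZ : Bool → 𝒵 → ℝ)
    (hWY : ∀ x, IsPMF (WY x)) (hWZ : ∀ x, IsPMF (WZ x))
    (hP0 : ∀ y, 0 < WY false y) (hQ0 : ∀ z, 0 < WZ false z)
    (hPneq : WY true ≠ WY false) (hQneq : WZ true ≠ WZ false)
    (Wdeg : 𝒴 → 𝒵 → ℝ) (hWdeg : ∀ y, IsPMF (Wdeg y))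
    (hdeg : ∀ x z, WZ x z = ∑ y, WY x y * Wdeg y z)
    (ζ δ : ℝ) (hζ : 0 < ζ) (hδ : 0 < δ) :
    ∃ N0 : ℕ, ∀ n, N0 ≤ n →
      ∃ (M K : ℕ) (_ : 1 ≤ M) (_ : 1 ≤ K)
        (f : Fin M → Fin K → Fin n → Bool) (g : (Fin n → 𝒴) → Fin K → Fin M),
        (Real.log M ≥
          (Real.sqrt (2 / chiDiv 2 (WZ true) (WZ false)) * KL (WY true) (WY false) - ζ)
            * Real.sqrt (n * δ)) ∧
        (Real.log K ≤ ζ * Real.sqrt (n * δ)) ∧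
        (((M : ℝ) * K)⁻¹ * ∑ w : Fin M, ∑ key : Fin K, ∑ y : Fin n → 𝒴,
            prodCh WY n y (f w key) * ind (g y key ≠ w) ≤ ζ) ∧
        KL (fun z : Fin n → 𝒵 => ((M : ℝ) * K)⁻¹ * ∑ w : Fin M, ∑ key : Fin K,
              prodCh WZ n z (f w key))
           (fun z => prodCh WZ n z (fun _ => false)) ≤ δ + ζ := by
  have hχ := chiDiv_two_pos hQ0 hQneq
  have hDP : 0 < KL (WY true) (WY false) := KL_pos (hWY true) (hWY false) hP0 hPneq
  have hcap : 0 < Real.sqrt (2 / chiDiv 2 (WZ true) (WZ false)) * KL (WY true) (WY false) :=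
    mul_pos (Real.sqrt_pos.2 (by positivity)) hDP
  have hKL := KL_le_of_degraded (hWY true) hP0 (hWZ true) hQ0 hWdeg (hdeg true) (hdeg false)
  obtain ⟨N0, hN0⟩ := exists_covert_code hWY hWZ hP0 hQ0 hχ hKL (lt_min hζ hcap) hδ
    (min_le_right _ _)
  have hmin := min_le_left ζ
    (Real.sqrt (2 / chiDiv 2 (WZ true) (WZ false)) * KL (WY true) (WY false))
  refine ⟨N0, fun n hn => ?_⟩
  obtain ⟨M, K, hM, hK, f, g, hrate, hkey, herr, hdiv⟩ := hN0 n hn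
  refine ⟨M, K, hM, hK, f, g, le_trans ?_ hrate, hkey.trans ?_, herr.trans hmin,
    hdiv.trans (by linarith)⟩
  · exact mul_le_mul_of_nonneg_right (by linarith) (Real.sqrt_nonneg _)
  · exact mul_le_mul_of_nonneg_right hmin (Real.sqrt_nonneg _)
end
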